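/- arXiv:1104.5401 — 2 statements merged into one kernel-verified Lean document; each statement's English description precedes it below -/
import Mathlib

section
/- Let ℱ be a collection of r-graphs each with at least t vertices, let 0 < p < 1, and let c = c(p,ℱ), i.e., Pr[G(n,p) ∈ Forb(ℱ)ⁿ] = 2^{(-c+o(1))·C(n,r)}. Then for every ε > 0 there exist n₀ and δ > 0 (depending only on ε, p, ℱ) such that for every n > n₀ and every collection 𝒜 of r-graphs on the vertex set {1,…,n} with Pr[G(n,p) ∈ 𝒜] > 2^{(-c+ε)·C(n,r)}, some graph G ∈ 𝒜 contains at least δ·n^t induced subgraphs each lying in ℱ, i.e., there are at least δ·n^t vertex subsets U such that the induced subgraph G[U] is isomorphic to a member of ℱ. -/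
open Finset

/-- The set of all potential edges of an `r`-uniform hypergraph on vertex set `Fin n`:
the `r`-element subsets of the vertex set. -/
def edgeUniv (r n : ℕ) : Finset (Finset (Fin n)) := Finset.powersetCard r Finset.univ

/-- `G` is an `r`-uniform hypergraph on `Fin n`: a set of `r`-element subsets of the vertices. -/
def IsRGraph (r n : ℕ) (G : Finset (Finset (Fin n))) : Prop := G ⊆ edgeUniv r n

/-- The probability that the random `r`-graph `G(n,p)` (each `r`-set being an edge
independently with probability `p`) belongs to the collection `A`. -/
noncomputable def prG (r n : ℕ) (p : ℝ) (A : Set (Finset (Finset (Fin n)))) : ℝ :=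
  ∑ E ∈ (edgeUniv r n).powerset,
    Set.indicator A (fun E => p ^ E.card * (1 - p) ^ ((edgeUniv r n).card - E.card)) E

/-- The `r`-graph `F` on `Fin k` appears as an induced subgraph of `G` (an `r`-graph on
`Fin n`) on the vertex subset `U`. -/
def IsInducedCopyAt (r k n : ℕ) (F : Finset (Finset (Fin k)))
    (G : Finset (Finset (Fin n))) (U : Finset (Fin n)) : Prop :=
  ∃ f : Fin k ↪ Fin n, Finset.univ.map f = U ∧
    ∀ e : Finset (Fin k), e.card = r → (e ∈ F ↔ e.map f ∈ G)

/-- `G` has an induced subgraph on the vertex subset `U` isomorphic to a member of the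
family `Fam` (where `Fam k` is the set of members of the family on `k` vertices). -/
def HasCopyAt (r n : ℕ) (Fam : ∀ k, Set (Finset (Finset (Fin k))))
    (G : Finset (Finset (Fin n))) (U : Finset (Fin n)) : Prop :=
  ∃ k, ∃ H ∈ Fam k, IsInducedCopyAt r k n H G U

/-- `Forb(Fam)ⁿ` : the `r`-graphs on `n` vertices with no induced subgraph isomorphic to a
member of `Fam`. -/
def ForbN (r : ℕ) (Fam : ∀ k, Set (Finset (Finset (Fin k)))) (n : ℕ) :
    Set (Finset (Finset (Fin n))) :=
  {G | IsRGraph r n G ∧ ∀ U, ¬ HasCopyAt r n Fam G U}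

/-- A partial Steiner system with parameters `(r,m,n)`: a collection of `m`-element
subsets of `Fin n` such that every `r`-element subset is contained in at most one member. -/
def IsSteiner (r m n : ℕ) (D : Finset (Finset (Fin n))) : Prop :=
  (∀ B ∈ D, B.card = m) ∧
  ∀ e : Finset (Fin n), e.card = r →
    ∀ B₁ ∈ D, ∀ B₂ ∈ D, e ⊆ B₁ → e ⊆ B₂ → B₁ = B₂

/-- Expectation over a random subset of `E` (each element kept with probability `p`). -/
noncomputable def ex {α : Type*} (p : ℝ) (E : Finset α) (f : Finset α → ℝ) : ℝ :=
  ∑ X ∈ E.powerset, p ^ X.card * (1 - p) ^ (E.card - X.card) * f X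

theorem ex_insert {α : Type*} [DecidableEq α] (p : ℝ) (E : Finset α) (a : α) (ha : a ∉ E)
    (f : Finset α → ℝ) :
    ex p (insert a E) f = p * ex p E (fun X => f (insert a X)) + (1 - p) * ex p E f := by
  unfold ex
  rw [Finset.sum_powerset_insert ha, add_comm, Finset.mul_sum, Finset.mul_sum]
  congr 1
  · refine Finset.sum_congr rfl fun X hX => ?_
    have hXE := Finset.mem_powerset.1 hX
    have haX : a ∉ X := fun h => ha (hXE h)
    rw [Finset.card_insert_of_notMem ha, Finset.card_insert_of_notMem haX,
      Nat.add_sub_add_right]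
    ring
  · refine Finset.sum_congr rfl fun X hX => ?_
    have hXE := Finset.card_le_card (Finset.mem_powerset.1 hX)
    rw [Finset.card_insert_of_notMem ha, Nat.sub_add_comm hXE, pow_succ]
    ring

theorem ex_mono {α : Type*} (p : ℝ) (hp0 : 0 ≤ p) (hp1 : p ≤ 1) (E : Finset α)
    (f g : Finset α → ℝ) (h : ∀ X ⊆ E, f X ≤ g X) : ex p E f ≤ ex p E g := by
  unfold ex
  refine Finset.sum_le_sum fun X hX => ?_
  have : 0 ≤ 1 - p := by linarith
  exact mul_le_mul_of_nonneg_left (h X (Finset.mem_powerset.1 hX)) (by positivity)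

theorem ex_congr {α : Type*} (p : ℝ) (E : Finset α)
    (f g : Finset α → ℝ) (h : ∀ X ⊆ E, f X = g X) : ex p E f = ex p E g := by
  unfold ex
  exact Finset.sum_congr rfl fun X hX => by rw [h X (Finset.mem_powerset.1 hX)]

theorem ex_nonneg {α : Type*} (p : ℝ) (hp0 : 0 ≤ p) (hp1 : p ≤ 1) (E : Finset α)
    (f : Finset α → ℝ) (h : ∀ X, 0 ≤ f X) : 0 ≤ ex p E f := by
  have : 0 ≤ 1 - p := by linarith
  exact Finset.sum_nonneg fun X _ => mul_nonneg (by positivity) (h X)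

theorem ex_const {α : Type*} (p : ℝ) (E : Finset α) (k : ℝ) :
    ex p E (fun _ => k) = k := by
  classical
  induction E using Finset.induction_on with
  | empty => simp [ex]
  | insert a E ha ih => rw [ex_insert p E a ha, ih]; ring

theorem ex_add {α : Type*} (p : ℝ) (E : Finset α) (f g : Finset α → ℝ) :
    ex p E (fun X => f X + g X) = ex p E f + ex p E g := by
  unfold ex
  rw [← Finset.sum_add_distrib]
  exact Finset.sum_congr rfl fun X _ => by ring

theorem ex_mul {α : Type*} (p : ℝ) (E : Finset α) (f : Finset α → ℝ) (k : ℝ) :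
    ex p E (fun X => f X * k) = ex p E f * k := by
  unfold ex
  rw [Finset.sum_mul]
  exact Finset.sum_congr rfl fun X _ => by ring

theorem ex_marginal {α : Type*} [DecidableEq α] (p : ℝ) (T D : Finset α) (hTD : Disjoint T D)
    (f : Finset α → ℝ) (hf : ∀ X, f (X ∩ T) = f X) :
    ex p (T ∪ D) f = ex p T f := by
  induction D using Finset.induction_on with
  | empty => simp
  | insert a D ha ih =>
    rw [Finset.disjoint_insert_right] at hTD
    rw [Finset.union_insert, ex_insert p _ a (by simp [ha, hTD.1]), ← ih hTD.2]
    have : (fun X => f (insert a X)) = f := by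
      funext X
      rw [← hf (insert a X), Finset.insert_inter_of_notMem hTD.1, hf]
    rw [this]; ring

theorem ex_map {α β : Type*} (p : ℝ) (φ : α ↪ β) (E : Finset α) (f : Finset β → ℝ) :
    ex p (E.map φ) f = ex p E (fun X => f (X.map φ)) := by
  classical
  induction E using Finset.induction_on generalizing f with
  | empty => simp [ex]
  | insert a E ha ih =>
    rw [Finset.map_insert, ex_insert p _ _ (by simpa using ha), ex_insert p _ _ ha, ih, ih]
    simp only [Finset.map_insert]

/-- Two-point Hölder inequality. -/
theorem holder_two {ι : Type*} (J : Finset ι) (w p : ℝ) (hw : 0 < w) (hp0 : 0 < p) (hp1 : p < 1)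
    (hJ : (J.card : ℝ) * w = 1) (u v : ι → ℝ) (hu : ∀ i, 0 ≤ u i) (hv : ∀ i, 0 ≤ v i) :
    p * ∏ i ∈ J, u i ^ w + (1 - p) * ∏ i ∈ J, v i ^ w ≤
      ∏ i ∈ J, (p * u i + (1 - p) * v i) ^ w := by
  have hq : 0 < 1 - p := by linarith
  have hs : ∀ i, 0 ≤ p * u i + (1 - p) * v i := fun i => by
    have := hu i; have := hv i; positivity
  by_cases h0 : ∃ i ∈ J, p * u i + (1 - p) * v i = 0
  · obtain ⟨i, hi, h⟩ := h0
    have h1 : u i = 0 := by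
      have a := mul_nonneg hq.le (hv i); have b := mul_nonneg hp0.le (hu i)
      have : p * u i = 0 := by linarith
      simpa [hp0.ne'] using this
    have h2 : v i = 0 := by
      rw [h1] at h
      simpa [hq.ne'] using h
    rw [Finset.prod_eq_zero hi (by rw [h1, Real.zero_rpow hw.ne']),
      Finset.prod_eq_zero hi (by rw [h2, Real.zero_rpow hw.ne'])]
    simp only [mul_zero, add_zero]
    exact Finset.prod_nonneg fun i _ => Real.rpow_nonneg (hs i) _
  · push Not at h0
    set s : ι → ℝ := fun i => p * u i + (1 - p) * v i with hsdef
    have hspos : ∀ i ∈ J, 0 < s i := fun i hi => lt_of_le_of_ne (hs i) (Ne.symm (h0 i hi))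
    have key : ∀ z : ι → ℝ, (∀ i, 0 ≤ z i) →
        ∏ i ∈ J, z i ^ w ≤ (∑ i ∈ J, w * (z i / s i)) * ∏ i ∈ J, s i ^ w := by
      intro z hz
      have h1 := Real.geom_mean_le_arith_mean_weighted J (fun _ => w) (fun i => z i / s i)
        (fun _ _ => hw.le) (by simpa using hJ) (fun i hi => div_nonneg (hz i) (hs i))
      have h2 : ∏ i ∈ J, z i ^ w = (∏ i ∈ J, (z i / s i) ^ w) * ∏ i ∈ J, s i ^ w := by
        rw [← Finset.prod_mul_distrib]
        refine Finset.prod_congr rfl fun i hi => ?_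
        rw [← Real.mul_rpow (div_nonneg (hz i) (hs i)) (hs i), div_mul_cancel₀ _ (hspos i hi).ne']
      rw [h2]
      exact mul_le_mul_of_nonneg_right h1
        (Finset.prod_nonneg fun i _ => Real.rpow_nonneg (hs i) _)
    have e : p * (∑ i ∈ J, w * (u i / s i)) + (1 - p) * (∑ i ∈ J, w * (v i / s i)) = 1 := by
      have hw1 : ∑ _i ∈ J, w = 1 := by simpa using hJ
      rw [Finset.mul_sum, Finset.mul_sum, ← Finset.sum_add_distrib]
      refine Eq.trans ?_ hw1
      refine Finset.sum_congr rfl fun i hi => ?_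
      have := (hspos i hi).ne'
      field_simp
      rfl
    have k1 := mul_le_mul_of_nonneg_left (key u hu) hp0.le
    have k2 := mul_le_mul_of_nonneg_left (key v hv) hq.le
    calc _ ≤ _ := add_le_add k1 k2
      _ = (p * (∑ i ∈ J, w * (u i / s i)) + (1 - p) * (∑ i ∈ J, w * (v i / s i)))
            * ∏ i ∈ J, s i ^ w := by ring
      _ = _ := by rw [e, one_mul]

/-- Finner's inequality for equal exponents. -/
theorem finner {α ι : Type*} [DecidableEq α] (p w : ℝ) (hw : 0 < w) (hp0 : 0 < p) (hp1 : p < 1)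
    (I : Finset ι) (T : ι → Finset α) (E : Finset α)
    (hT : ∀ a ∈ E, ((I.filter (fun i => a ∈ T i)).card : ℝ) * w = 1)
    (g : ι → Finset α → ℝ) (hg0 : ∀ i X, 0 ≤ g i X)
    (hg : ∀ i X a, a ∉ T i → g i (insert a X) = g i X) :
    ex p E (fun X => ∏ i ∈ I, g i X ^ w) ≤ ∏ i ∈ I, (ex p E (g i)) ^ w := by
  induction E using Finset.induction_on generalizing g with
  | empty => simp [ex]
  | insert a E ha ih =>
    have hq : 0 < 1 - p := by linarith
    have ih' := ih (fun b hb => hT b (Finset.mem_insert_of_mem hb))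
    have i1 := ih' (fun i X => g i (insert a X)) (fun i X => hg0 i _)
      (fun i X b hb => by simp only [Finset.insert_comm a b]; exact hg i _ b hb)
    have i2 := ih' g hg0 hg
    rw [ex_insert p E a ha]
    set u : ι → ℝ := fun i => ex p E (fun X => g i (insert a X)) with hudef
    set v : ι → ℝ := fun i => ex p E (g i) with hvdef
    have hu : ∀ i, 0 ≤ u i := fun i => ex_nonneg p hp0.le hp1.le E _ fun X => hg0 i _
    have hv : ∀ i, 0 ≤ v i := fun i => ex_nonneg p hp0.le hp1.le E _ fun X => hg0 i _
    have huv : ∀ i, a ∉ T i → u i = v i := fun i hi =>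
      congrArg (ex p E) (funext fun X => hg i X a hi)
    have hJ := hT a (Finset.mem_insert_self _ _)
    have hold := holder_two _ w p hw hp0 hp1 hJ u v hu hv
    have eu : ∏ i ∈ I, u i ^ w = (∏ i ∈ I with a ∈ T i, u i ^ w) *
        ∏ i ∈ I with a ∉ T i, v i ^ w := by
      rw [← Finset.prod_filter_mul_prod_filter_not I (fun i => a ∈ T i)]
      congr 1
      refine Finset.prod_congr rfl fun i hi => ?_
      rw [huv i (Finset.mem_filter.1 hi).2]
    have ev : ∏ i ∈ I, v i ^ w = (∏ i ∈ I with a ∈ T i, v i ^ w) *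
        ∏ i ∈ I with a ∉ T i, v i ^ w :=
      (Finset.prod_filter_mul_prod_filter_not I (fun i => a ∈ T i) _).symm
    have es : ∏ i ∈ I, (ex p (insert a E) (g i)) ^ w =
        (∏ i ∈ I with a ∈ T i, (p * u i + (1 - p) * v i) ^ w) *
        ∏ i ∈ I with a ∉ T i, v i ^ w := by
      rw [← Finset.prod_filter_mul_prod_filter_not I (fun i => a ∈ T i)]
      congr 1
      · refine Finset.prod_congr rfl fun i hi => ?_
        rw [ex_insert p E a ha]
      · refine Finset.prod_congr rfl fun i hi => ?_
        rw [ex_insert p E a ha]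
        change (p * u i + (1 - p) * v i) ^ w = _
        rw [huv i (Finset.mem_filter.1 hi).2]
        congr 1; ring
    rw [es]
    calc _ ≤ p * ∏ i ∈ I, u i ^ w + (1 - p) * ∏ i ∈ I, v i ^ w :=
          add_le_add (mul_le_mul_of_nonneg_left i1 hp0.le) (mul_le_mul_of_nonneg_left i2 hq.le)
      _ = (p * ∏ i ∈ I with a ∈ T i, u i ^ w + (1 - p) * ∏ i ∈ I with a ∈ T i, v i ^ w) *
          ∏ i ∈ I with a ∉ T i, v i ^ w := by rw [eu, ev]; ring
      _ ≤ _ := mul_le_mul_of_nonneg_right hold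
          (Finset.prod_nonneg fun i _ => Real.rpow_nonneg (hv i) _)

theorem copy_congr (r n : ℕ) (Fam : ∀ k, Set (Finset (Finset (Fin k))))
    (X Y : Finset (Finset (Fin n))) (U : Finset (Fin n))
    (h : ∀ e, e ⊆ U → e.card = r → (e ∈ X ↔ e ∈ Y)) (hX : HasCopyAt r n Fam X U) :
    HasCopyAt r n Fam Y U := by
  obtain ⟨k, H, hH, f, hf, hE⟩ := hX
  refine ⟨k, H, hH, f, hf, fun e he => ?_⟩
  rw [hE e he]
  refine h _ ?_ (by simpa using he)
  rw [← hf]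
  exact Finset.map_subset_map.2 (Finset.subset_univ e)

/-- `S` contains the vertex set of some induced member of the family. -/
def BadAt (r n : ℕ) (Fam : ∀ k, Set (Finset (Finset (Fin k))))
    (X : Finset (Finset (Fin n))) (S : Finset (Fin n)) : Prop :=
  ∃ U ⊆ S, HasCopyAt r n Fam X U

theorem bad_congr (r n : ℕ) (Fam : ∀ k, Set (Finset (Finset (Fin k))))
    (X Y : Finset (Finset (Fin n))) (S : Finset (Fin n))
    (h : ∀ e, e ⊆ S → e.card = r → (e ∈ X ↔ e ∈ Y)) :
    BadAt r n Fam X S ↔ BadAt r n Fam Y S := by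
  constructor
  · rintro ⟨U, hU, hc⟩
    exact ⟨U, hU, copy_congr r n Fam X Y U (fun e he hr => h e (he.trans hU) hr) hc⟩
  · rintro ⟨U, hU, hc⟩
    exact ⟨U, hU, copy_congr r n Fam Y X U (fun e he hr => (h e (he.trans hU) hr).symm) hc⟩

theorem bad_map (r m n : ℕ) (Fam : ∀ k, Set (Finset (Finset (Fin k)))) (φ : Fin m ↪ Fin n)
    (Y : Finset (Finset (Fin m))) (V : Finset (Fin m)) (h : HasCopyAt r m Fam Y V) :
    BadAt r n Fam (Y.map (Finset.mapEmbedding φ).toEmbedding) (Finset.univ.map φ) := by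
  obtain ⟨k, H, hH, f, hf, hE⟩ := h
  refine ⟨V.map φ, Finset.map_subset_map.2 (Finset.subset_univ _), k, H, hH, f.trans φ, ?_, ?_⟩
  · rw [← Finset.map_map, hf]
  · intro e he
    rw [hE e he, ← Finset.map_map]
    exact (Finset.mem_map' (Finset.mapEmbedding φ).toEmbedding).symm

theorem bad_count (r t m n : ℕ) (hn : 0 < n) (Fam : ∀ k, Set (Finset (Finset (Fin k))))
    (hFam : ∀ k, ∀ H ∈ Fam k, IsRGraph r k H ∧ t ≤ k) (X : Finset (Finset (Fin n)))
    [DecidablePred (BadAt r n Fam X)] :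
    ((Finset.powersetCard m Finset.univ).filter (BadAt r n Fam X)).card ≤
      Set.ncard {U : Finset (Fin n) | HasCopyAt r n Fam X U} * n ^ (m - t) := by
  classical
  rw [Set.ncard_eq_toFinset_card']
  refine le_trans (Finset.card_le_card (t := (Set.toFinset {U | HasCopyAt r n Fam X U}).biUnion
    (fun U => (Finset.powersetCard m Finset.univ).filter (U ⊆ ·))) ?_) ?_
  · intro S hS
    obtain ⟨hS1, U, hU, hc⟩ := Finset.mem_filter.1 hS
    exact Finset.mem_biUnion.2 ⟨U, by simpa using hc, Finset.mem_filter.2 ⟨hS1, hU⟩⟩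
  · refine Finset.card_biUnion_le_card_mul _ _ _ fun U hU => ?_
    have hU' : HasCopyAt r n Fam X U := by simpa using hU
    have htU : t ≤ U.card := by
      obtain ⟨k, H, hH, f, hf, -⟩ := hU'
      rw [← hf, Finset.card_map, Finset.card_univ, Fintype.card_fin]
      exact (hFam k H hH).2
    by_cases hUm : U.card ≤ m
    · rw [Finset.card_filter_powersetCard_subset U _ m (Finset.subset_univ _) hUm]
      calc _ ≤ (#(Finset.univ : Finset (Fin n)) - #U) ^ (m - #U) := Nat.choose_le_pow _ _
        _ ≤ n ^ (m - #U) := Nat.pow_le_pow_left (by simp) _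
        _ ≤ n ^ (m - t) := Nat.pow_le_pow_right hn (by omega)
    · rw [Finset.filter_false_of_mem]
      · simp
      · intro S hS hUS
        have := Finset.card_le_card hUS
        rw [(Finset.mem_powersetCard.1 hS).2] at this
        exact hUm this

theorem prG_eq (r n : ℕ) (p : ℝ) (A : Set (Finset (Finset (Fin n)))) :
    prG r n p A = ex p (edgeUniv r n) (Set.indicator A (fun _ => 1)) := by
  unfold prG ex
  refine Finset.sum_congr rfl fun X _ => ?_
  by_cases h : X ∈ A <;> simp [h]

open Classical in
/-- Weight of an `m`-set: `1` if it is clean, `μ` otherwise. -/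
noncomputable def gw (r n : ℕ) (Fam : ∀ k, Set (Finset (Finset (Fin k)))) (μ : ℝ)
    (S : Finset (Fin n)) (X : Finset (Finset (Fin n))) : ℝ :=
  if BadAt r n Fam X S then μ else 1

theorem ex_gw_le (r m n : ℕ) (Fam : ∀ k, Set (Finset (Finset (Fin k)))) (p : ℝ) (hp0 : 0 ≤ p)
    (hp1 : p ≤ 1) (μ : ℝ) (hμ : 0 ≤ μ) (S : Finset (Fin n)) (hS : S.card = m) :
    ex p (edgeUniv r n) (gw r n Fam μ S) ≤ prG r m p (ForbN r Fam m) + μ := by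
  classical
  have hTsub : S.powersetCard r ⊆ edgeUniv r n :=
    Finset.powersetCard_mono (Finset.subset_univ S)
  have h1 : ex p (edgeUniv r n) (gw r n Fam μ S) = ex p (S.powersetCard r) (gw r n Fam μ S) := by
    rw [← Finset.union_sdiff_of_subset hTsub]
    refine ex_marginal p _ _ Finset.disjoint_sdiff _ fun X => ?_
    unfold gw
    have := bad_congr r n Fam (X ∩ S.powersetCard r) X S (fun e he hr => by
      simp [Finset.mem_powersetCard, he, hr])
    simp only [this]
  have hφ : Finset.univ.map (S.orderEmbOfFin hS).toEmbedding = S := by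
    simp
  rw [h1]
  generalize hφe : (S.orderEmbOfFin hS).toEmbedding = φ at hφ
  have h2 : S.powersetCard r = (edgeUniv r m).map (Finset.mapEmbedding φ).toEmbedding := by
    rw [edgeUniv, ← Finset.powersetCard_map, hφ]
  rw [h2, ex_map, prG_eq, ← ex_const p (edgeUniv r m) μ, ← ex_add]
  refine ex_mono p hp0 hp1 _ _ _ fun Y hY => ?_
  rw [ex_const]
  by_cases hb : Y ∈ ForbN r Fam m
  · simp only [gw, Set.indicator_of_mem hb]
    split_ifs
    · linarith
    · linarith
  · have : ∃ V, HasCopyAt r m Fam Y V := by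
      by_contra hne
      push Not at hne
      exact hb ⟨hY, hne⟩
    obtain ⟨V, hV⟩ := this
    have hbad := bad_map r m n Fam φ Y V hV
    rw [hφ] at hbad
    simp [gw, hbad, Set.indicator_of_notMem hb]

/-- Core estimate. -/
theorem core (r m n : ℕ) (hrm : r ≤ m) (hmn : m ≤ n)
    (Fam : ∀ k, Set (Finset (Finset (Fin k)))) (p : ℝ) (hp0 : 0 < p)
    (hp1 : p < 1) (μ : ℝ) (hμ : 0 < μ) (hμ1 : μ ≤ 1) (β : ℝ)
    (A : Set (Finset (Finset (Fin n))))
    (hA : ∀ G ∈ A, ∀ inst : DecidablePred (BadAt r n Fam G),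
      (((Finset.powersetCard m Finset.univ).filter (BadAt r n Fam G)).card : ℝ) ≤
      β * (n.choose m : ℝ)) :
    prG r n p A * μ ^ (β * ((n.choose r : ℝ) / (m.choose r : ℝ))) ≤
      (prG r m p (ForbN r Fam m) + μ) ^ ((n.choose r : ℝ) / (m.choose r : ℝ)) := by
  classical
  have hKpos : 0 < (n - r).choose (m - r) := Nat.choose_pos (by omega)
  have hMpos : 0 < m.choose r := Nat.choose_pos hrm
  set K : ℝ := ((n - r).choose (m - r) : ℝ) with hK
  have hK0 : 0 < K := Nat.cast_pos.2 hKpos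
  have hM0 : 0 < (m.choose r : ℝ) := by exact_mod_cast hMpos
  have hNK : (n.choose m : ℝ) * K⁻¹ = (n.choose r : ℝ) / (m.choose r : ℝ) := by
    have : (n.choose m : ℝ) * (m.choose r : ℝ) = (n.choose r : ℝ) * K := by
      rw [hK]
      exact_mod_cast Nat.choose_mul (n := n) hrm
    field_simp
    linarith
  have hw : 0 < K⁻¹ := inv_pos.2 hK0
  have hgpos : ∀ S X, 0 < gw r n Fam μ S X := fun S X => by
    unfold gw; split_ifs <;> [exact hμ; exact one_pos]
  have hfin := finner p K⁻¹ hw hp0 hp1 (Finset.powersetCard m (Finset.univ : Finset (Fin n)))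
    (fun S => S.powersetCard r) (edgeUniv r n) (by
      intro a ha
      have har : a.card = r := (Finset.mem_powersetCard.1 ha).2
      have : (Finset.powersetCard m (Finset.univ : Finset (Fin n))).filter
          (fun S => a ∈ S.powersetCard r) =
          (Finset.powersetCard m (Finset.univ : Finset (Fin n))).filter (a ⊆ ·) := by
        refine Finset.filter_congr fun S _ => ?_
        simp [Finset.mem_powersetCard, har]
      rw [this, Finset.card_filter_powersetCard_subset a _ m (Finset.subset_univ _) (by omega),
        har, Finset.card_univ, Fintype.card_fin]
      exact mul_inv_cancel₀ hK0.ne')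
    (gw r n Fam μ) (fun S X => (hgpos S X).le) (by
      intro S X a ha
      have := bad_congr r n Fam (insert a X) X S (fun e he hr => by
        have : e ≠ a := by
          rintro rfl
          exact ha (Finset.mem_powersetCard.2 ⟨he, hr⟩)
        simp [this])
      simp only [gw, this])
  have hlow : prG r n p A * μ ^ (β * ((n.choose r : ℝ) / (m.choose r : ℝ))) ≤
      ex p (edgeUniv r n) (fun X => ∏ S ∈ Finset.powersetCard m (Finset.univ : Finset (Fin n)),
        gw r n Fam μ S X ^ K⁻¹) := by
    rw [prG_eq, ← ex_mul]
    refine ex_mono p hp0.le hp1.le _ _ _ fun X _ => ?_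
    by_cases hX : X ∈ A
    · rw [Set.indicator_of_mem hX, one_mul]
      have e1 : ∏ S ∈ Finset.powersetCard m (Finset.univ : Finset (Fin n)),
          gw r n Fam μ S X ^ K⁻¹ = μ ^ (K⁻¹ * (((Finset.powersetCard m
            (Finset.univ : Finset (Fin n))).filter (BadAt r n Fam X)).card : ℝ)) := by
        rw [Real.rpow_mul hμ.le, Real.rpow_natCast, ← Finset.prod_const, Finset.prod_filter]
        refine Finset.prod_congr rfl fun S _ => ?_
        unfold gw
        split_ifs <;> simp
      rw [e1]
      refine Real.rpow_le_rpow_of_exponent_ge hμ hμ1 ?_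
      rw [← hNK]
      have := mul_le_mul_of_nonneg_left (hA X hX inferInstance) hw.le
      linarith
    · rw [Set.indicator_of_notMem hX, zero_mul]
      exact Finset.prod_nonneg fun S _ => Real.rpow_nonneg (hgpos S X).le _
  refine hlow.trans (hfin.trans ?_)
  have hq0 : 0 ≤ prG r m p (ForbN r Fam m) := by
    rw [prG_eq]
    exact ex_nonneg p hp0.le hp1.le _ _ fun X => Set.indicator_nonneg (fun _ _ => zero_le_one) _
  calc _ ≤ ∏ S ∈ Finset.powersetCard m (Finset.univ : Finset (Fin n)),
        (prG r m p (ForbN r Fam m) + μ) ^ K⁻¹ := by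
        refine Finset.prod_le_prod (fun S _ => Real.rpow_nonneg
          (ex_nonneg p hp0.le hp1.le _ _ fun X => (hgpos S X).le) _) fun S hS => ?_
        exact Real.rpow_le_rpow (ex_nonneg p hp0.le hp1.le _ _ fun X => (hgpos S X).le)
          (ex_gw_le r m n Fam p hp0.le hp1.le μ hμ.le S (Finset.mem_powersetCard.1 hS).2) hw.le
    _ = _ := by
        rw [Finset.prod_const, Finset.card_powersetCard, Finset.card_univ, Fintype.card_fin,
          ← Real.rpow_natCast, ← Real.rpow_mul (by positivity), ← hNK, mul_comm]

/-- **Main theorem (supersaturation for hereditary properties).** Let `Fam` be a collection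
of `r`-graphs each with at least `t` vertices, `0 < p < 1`, and let `c = c(p,Fam)` be the
limit of `-log₂ Pr[G(n,p) ∈ Forb(Fam)ⁿ] / C(n,r)`. For every `ε > 0` there are `n₀` and
`δ > 0` such that for `n > n₀`, any collection `A` of `r`-graphs on `n` vertices with
`Pr[G(n,p) ∈ A] > 2 ^ ((-c+ε) C(n,r))` has a member containing at least `δ n^t` induced
subgraphs lying in `Fam`. -/
theorem stmt_2 (r t : ℕ) (Fam : ∀ k, Set (Finset (Finset (Fin k))))
    (hFam : ∀ k, ∀ H ∈ Fam k, IsRGraph r k H ∧ t ≤ k)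
    (p : ℝ) (hp0 : 0 < p) (hp1 : p < 1) (c : ℝ)
    (hc : Filter.Tendsto
      (fun n => -(Real.logb 2 (prG r n p (ForbN r Fam n))) / (n.choose r : ℝ))
      Filter.atTop (nhds c))
    (ε : ℝ) (hε : 0 < ε) :
    ∃ (n₀ : ℕ) (δ : ℝ), 0 < δ ∧ ∀ n, n₀ < n →
      ∀ A : Set (Finset (Finset (Fin n))), (∀ G ∈ A, IsRGraph r n G) →
      2 ^ ((-c + ε) * (n.choose r : ℝ)) < prG r n p A →
      ∃ G ∈ A, δ * (n : ℝ) ^ t ≤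
        (Set.ncard {U : Finset (Fin n) | HasCopyAt r n Fam G U} : ℝ) := by
  have hev' : ∀ᶠ n : ℕ in Filter.atTop, c - ε / 3 <
      -(Real.logb 2 (prG r n p (ForbN r Fam n))) / (n.choose r : ℝ) :=
    hc.eventually_const_lt (by linarith)
  obtain ⟨m, hm, hmr, hmt, hm1⟩ := (hev'.and ((Filter.eventually_ge_atTop r).and
    ((Filter.eventually_ge_atTop t).and (Filter.eventually_ge_atTop 1)))).exists
  have hM0 : (0 : ℝ) < (m.choose r : ℝ) := by exact_mod_cast Nat.choose_pos hmr
  set M : ℝ := (m.choose r : ℝ) with hM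
  set q : ℝ := prG r m p (ForbN r Fam m) with hq
  have hq0 : 0 ≤ q := by
    rw [hq, prG_eq]
    exact ex_nonneg p hp0.le hp1.le _ _ fun X => Set.indicator_nonneg (fun _ _ => zero_le_one) _
  have hqB : q ≤ 2 ^ ((-c + ε / 3) * M) := by
    rcases hq0.eq_or_lt with h | h
    · rw [← h]; positivity
    · rw [lt_div_iff₀ hM0] at hm
      rw [← Real.logb_le_iff_le_rpow one_lt_two h]
      linarith
  have hBB : (2 : ℝ) ^ ((-c + ε / 3) * M) < 2 ^ ((-c + 2 * ε / 3) * M) :=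
    Real.rpow_lt_rpow_of_exponent_lt one_lt_two (mul_lt_mul_of_pos_right (by linarith) hM0)
  obtain ⟨L, hL⟩ := exists_pow_lt_of_lt_one (sub_pos.2 hBB) (show (1 / 2 : ℝ) < 1 by norm_num)
  set μ : ℝ := (1 / 2 : ℝ) ^ L with hμ
  have hμ0 : 0 < μ := by positivity
  have hμ1 : μ ≤ 1 := pow_le_one₀ (by norm_num) (by norm_num)
  have hμL : μ = 2 ^ (-(L : ℝ)) := by
    rw [Real.rpow_neg two_pos.le, Real.rpow_natCast, hμ, one_div, inv_pow]
  set β : ℝ := ε / 3 * M / (L + 1) with hβ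
  have hβ0 : 0 < β := by positivity
  have hβL : β * L ≤ ε / 3 * M := by
    rw [hβ, div_mul_eq_mul_div, div_le_iff₀ (by positivity)]
    exact mul_le_mul_of_nonneg_left (by linarith) (by positivity)
  refine ⟨2 * m, β / (2 ^ m * (m.factorial : ℝ)), by positivity, fun n hn A hAr hA => ?_⟩
  by_contra hcon
  push Not at hcon
  have hn0 : 0 < n := by omega
  have hchoose : (n : ℝ) ^ m ≤ 2 ^ m * (m.factorial : ℝ) * (n.choose m : ℝ) := by
    have h1 : (n + 1 - m) ^ m ≤ m.factorial * n.choose m := by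
      rw [← Nat.descFactorial_eq_factorial_mul_choose]
      exact n.pow_sub_le_descFactorial m
    have h2 : n ^ m ≤ 2 ^ m * m.factorial * n.choose m := by
      calc n ^ m ≤ (2 * (n + 1 - m)) ^ m := Nat.pow_le_pow_left (by omega) _
        _ = 2 ^ m * (n + 1 - m) ^ m := mul_pow _ _ _
        _ ≤ 2 ^ m * (m.factorial * n.choose m) := Nat.mul_le_mul_left _ h1
        _ = _ := by ring
    exact_mod_cast h2
  have hcore := core r m n hmr (by omega) Fam p hp0 hp1 μ hμ0 hμ1 β A (by
    intro G hG inst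
    have h1 := bad_count r t m n hn0 Fam hFam G
    have h2 := (hcon G hG).le
    have h1' : (((Finset.powersetCard m Finset.univ).filter (BadAt r n Fam G)).card : ℝ) ≤
      (Set.ncard {U : Finset (Fin n) | HasCopyAt r n Fam G U} : ℝ) * (n : ℝ) ^ (m - t) := by
      exact_mod_cast h1
    calc _ ≤ _ := h1'
      _ ≤ β / (2 ^ m * (m.factorial : ℝ)) * (n : ℝ) ^ t * (n : ℝ) ^ (m - t) :=
        mul_le_mul_of_nonneg_right h2 (by positivity)
      _ = β / (2 ^ m * (m.factorial : ℝ)) * (n : ℝ) ^ m := by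
        rw [mul_assoc, ← pow_add, Nat.add_sub_cancel' hmt]
      _ ≤ β / (2 ^ m * (m.factorial : ℝ)) * (2 ^ m * (m.factorial : ℝ) * (n.choose m : ℝ)) :=
        mul_le_mul_of_nonneg_left hchoose (by positivity)
      _ = _ := by field_simp)
  set N : ℝ := (n.choose r : ℝ) with hN
  have hN0 : 0 ≤ N := by positivity
  have hup : (q + μ) ^ (N / M) ≤ 2 ^ ((-c + 2 * ε / 3) * N) := by
    calc (q + μ) ^ (N / M) ≤ (2 ^ ((-c + 2 * ε / 3) * M)) ^ (N / M) :=
          Real.rpow_le_rpow (by positivity) (by linarith) (by positivity)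
      _ = _ := by
        rw [← Real.rpow_mul two_pos.le]
        congr 1
        field_simp
  have hlow : (2 : ℝ) ^ (-(ε / 3) * N) ≤ μ ^ (β * (N / M)) := by
    rw [hμL, ← Real.rpow_mul two_pos.le]
    refine Real.rpow_le_rpow_of_exponent_le one_le_two ?_
    have := mul_le_mul_of_nonneg_right hβL (show 0 ≤ N / M by positivity)
    have e : ε / 3 * M * (N / M) = ε / 3 * N := by field_simp
    linarith
  have h3 : prG r n p A * 2 ^ (-(ε / 3) * N) ≤ 2 ^ ((-c + 2 * ε / 3) * N) := by
    refine le_trans (mul_le_mul_of_nonneg_left hlow ?_) (hcore.trans hup)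
    exact (lt_trans (by positivity) hA).le
  have h4 : (2 : ℝ) ^ ((-c + ε) * N) * 2 ^ (-(ε / 3) * N) < 2 ^ ((-c + 2 * ε / 3) * N) :=
    lt_of_lt_of_le (mul_lt_mul_of_pos_right hA (by positivity)) h3
  rw [← Real.rpow_add two_pos] at h4
  refine absurd h4 (not_lt.2 (le_of_eq ?_))
  congr 1
  ring
end

section
/- (Rödl) For all integers r < m and every λ > 0, there exists n₀ such that for every n > n₀ there exists a partial Steiner system 𝒟 with parameters (r,m,n) satisfying |𝒟| ≥ (1-λ)·C(n,r)·C(m,r)^{-1}. -/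
open Finset

namespace Nib

noncomputable section

/-- degree -/
def deg {α : Type} [DecidableEq α] (E : Finset (Finset α)) (v : α) : ℕ := #{e ∈ E | v ∈ e}

/-- codegree -/
def codeg {α : Type} [DecidableEq α] (E : Finset (Finset α)) (v w : α) : ℕ :=
  #{e ∈ E | v ∈ e ∧ w ∈ e}

/-- relative deviation of the degree from `D` -/
def dev {α : Type} [DecidableEq α] (E : Finset (Finset α)) (D : ℝ) (v : α) : ℝ :=
  |(deg E v : ℝ) - D| / D

/-- edges touching `S` -/
def touch {α : Type} [DecidableEq α] (E : Finset (Finset α)) (S : Finset α) :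
    Finset (Finset α) := {e ∈ E | ¬ Disjoint e S}

/-- expectation over a `p`-random subset of `E` -/
def Ex {β : Type} [DecidableEq β] (p : ℝ) (E : Finset β) (F : Finset β → ℝ) : ℝ :=
  ∑ X ∈ E.powerset, p ^ #X * (1 - p) ^ (#E - #X) * F X

section Exp
variable {β : Type} [DecidableEq β] (p : ℝ) (E : Finset β)

lemma Ex_add (F G : Finset β → ℝ) : Ex p E (fun X => F X + G X) = Ex p E F + Ex p E G := by
  simp [Ex, mul_add, sum_add_distrib]

lemma Ex_sub (F G : Finset β → ℝ) : Ex p E (fun X => F X - G X) = Ex p E F - Ex p E G := by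
  simp [Ex, mul_sub, sum_sub_distrib]

lemma Ex_mul (c : ℝ) (F : Finset β → ℝ) : Ex p E (fun X => c * F X) = c * Ex p E F := by
  simp only [Ex, mul_sum]
  exact sum_congr rfl fun _ _ => by ring

lemma Ex_sum {ι : Type} (s : Finset ι) (F : ι → Finset β → ℝ) :
    Ex p E (fun X => ∑ i ∈ s, F i X) = ∑ i ∈ s, Ex p E (F i) := by
  simp only [Ex, mul_sum]
  exact sum_comm

lemma Ex_congr {F G : Finset β → ℝ} (h : ∀ X ⊆ E, F X = G X) : Ex p E F = Ex p E G := by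
  unfold Ex
  exact sum_congr rfl fun X hX => by rw [h X (mem_powerset.1 hX)]

lemma Ex_one : Ex p E (fun _ => 1) = 1 := by
  simp only [Ex, mul_one]
  rw [Finset.sum_pow_mul_eq_add_pow]; simp

lemma Ex_const (c : ℝ) : Ex p E (fun _ => c) = c := by
  have := Ex_mul p E c (fun _ => 1)
  simpa [Ex_one] using this

lemma Ex_disj (T : Finset β) (hT : T ⊆ E) :
    Ex p E (fun X => if Disjoint X T then 1 else 0) = (1 - p) ^ #T := by
  have h1 : E.powerset.filter (fun X => Disjoint X T) = (E \ T).powerset := by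
    ext X; simp [subset_sdiff]
  simp only [Ex, mul_ite, mul_one, mul_zero]
  rw [← sum_filter, h1]
  have h2 : ∀ X ∈ (E \ T).powerset, p ^ #X * (1 - p) ^ (#E - #X)
      = (1 - p) ^ #T * (p ^ #X * (1 - p) ^ (#(E \ T) - #X)) := by
    intro X hX
    have h3 := card_le_card (mem_powerset.1 hX)
    have h4 := card_sdiff_of_subset hT
    have h5 := card_le_card hT
    have : #E - #X = #T + (#(E \ T) - #X) := by omega
    rw [this, pow_add]; ring
  rw [sum_congr rfl h2, ← mul_sum, Finset.sum_pow_mul_eq_add_pow]; simp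

lemma Ex_pair {e f : β} (he : e ∈ E) (hf : f ∈ E) (hef : e ≠ f) :
    Ex p E (fun X => if e ∈ X ∧ f ∈ X then 1 else 0) = p ^ 2 := by
  have h := Ex_disj p E {e} (by simpa using he)
  have h' := Ex_disj p E {f} (by simpa using hf)
  have h'' := Ex_disj p E {e, f} (by intro x; simp; rintro (rfl | rfl) <;> assumption)
  have : Ex p E (fun X => if e ∈ X ∧ f ∈ X then 1 else 0) =
      Ex p E (fun X => ((1 - (if Disjoint X {e} then 1 else 0)) - (if Disjoint X {f} then 1 else 0))
        + (if Disjoint X {e, f} then 1 else 0)) := by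
    apply Ex_congr
    intro X _
    by_cases h1 : e ∈ X <;> by_cases h2 : f ∈ X <;> simp [h1, h2]
  rw [this, Ex_add, Ex_sub, Ex_sub, h, h', h'', Ex_one, card_pair hef]
  simp; ring

lemma Ex_exists (hp : 0 ≤ p) (hp1 : p ≤ 1) (F : Finset β → ℝ) : ∃ X ⊆ E, F X ≤ Ex p E F := by
  by_contra! h
  have hw : ∀ X : Finset β, 0 ≤ p ^ #X * (1 - p) ^ (#E - #X) := fun X => by
    have : 0 ≤ 1 - p := by linarith
    positivity
  have h1 : Ex p E (fun X => F X - Ex p E F) = 0 := by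
    rw [Ex_sub, Ex_const]; ring
  have h2 := Ex_one p E
  unfold Ex at h1
  rw [sum_eq_zero_iff_of_nonneg] at h1
  · have : Ex p E (fun _ => 1) = 0 := by
      unfold Ex
      apply sum_eq_zero
      intro X hX
      have h3 := h1 X hX
      have h4 := h X (mem_powerset.1 hX)
      rcases mul_eq_zero.1 h3 with h5 | h5
      · rw [h5]; ring
      · unfold Ex at h4; linarith
    linarith
  · intro X hX
    exact mul_nonneg (hw X) (by have := h X (mem_powerset.1 hX); unfold Ex at this; linarith)

end Exp

section Basic
variable {α : Type} [DecidableEq α]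

/-- Bonferroni-type bounds for the number of edges touching `S`. -/
lemma touch_le (E : Finset (Finset α)) (S : Finset α) : #(touch E S) ≤ ∑ w ∈ S, deg E w := by
  have : touch E S ⊆ S.biUnion (fun w => {e ∈ E | w ∈ e}) := by
    intro e he
    simp only [touch, mem_filter, not_disjoint_iff] at he
    obtain ⟨h1, w, h2, h3⟩ := he
    simp only [mem_biUnion, mem_filter]
    exact ⟨w, h3, h1, h2⟩
  exact (card_le_card this).trans card_biUnion_le

lemma le_touch (E : Finset (Finset α)) (S : Finset α) :
    ∑ w ∈ S, deg E w ≤ #(touch E S) + ∑ z ∈ S.offDiag, codeg E z.1 z.2 := by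
  have h1 : ∑ w ∈ S, deg E w = ∑ e ∈ E, #{w ∈ S | w ∈ e} := by
    simp only [deg, card_filter]; exact sum_comm
  have h2 : ∑ z ∈ S.offDiag, codeg E z.1 z.2 = ∑ e ∈ E, #{z ∈ S.offDiag | z.1 ∈ e ∧ z.2 ∈ e} := by
    simp only [codeg, card_filter]; exact sum_comm
  have h3 : #(touch E S) = ∑ e ∈ E, if ¬ Disjoint e S then 1 else 0 := by
    simp only [touch, card_filter]
  rw [h1, h2, h3, ← sum_add_distrib]
  apply sum_le_sum
  intro e _
  have h4 : ({z ∈ S.offDiag | z.1 ∈ e ∧ z.2 ∈ e} : Finset (α × α)) = ({w ∈ S | w ∈ e}).offDiag := by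
    ext z; simp only [mem_filter, mem_offDiag]; tauto
  rw [h4, offDiag_card]
  set t := #{w ∈ S | w ∈ e} with ht
  by_cases hd : Disjoint e S
  · have : t = 0 := by
      rw [ht, card_eq_zero, filter_eq_empty_iff]
      intro w hw hwe
      exact (disjoint_left.1 hd) hwe hw
    simp [this]
  · simp only [hd, not_false_eq_true, if_true]
    rcases Nat.lt_or_ge t 2 with h | h
    · omega
    · have : t * 2 ≤ t * t := Nat.mul_le_mul_left _ h
      omega

lemma sum_deg_comm (E : Finset (Finset α)) (V : Finset α) (hE : ∀ e ∈ E, e ⊆ V)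
    (g : α → Finset α → ℝ) :
    ∑ v ∈ V, ∑ e ∈ E with v ∈ e, g v e = ∑ e ∈ E, ∑ v ∈ e, g v e := by
  simp only [sum_filter]
  rw [sum_comm]
  apply sum_congr rfl
  intro e he
  rw [← sum_filter]
  congr 1
  ext v; simp only [mem_filter]
  exact ⟨fun h => h.2, fun h => ⟨hE e he h, h⟩⟩


lemma abs_exp_sub {a b : ℝ} (ha : 0 ≤ a) (hb : 0 ≤ b) :
    |Real.exp (-a) - Real.exp (-b)| ≤ |a - b| := by
  wlog h : a ≤ b with H
  · rw [abs_sub_comm, abs_sub_comm a b]; exact H hb ha (le_of_not_ge h)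
  have h1 : Real.exp (-b) ≤ Real.exp (-a) := Real.exp_le_exp.2 (by linarith)
  have h2 : Real.exp (-b) = Real.exp (-a) * Real.exp (-(b - a)) := by
    rw [← Real.exp_add]; congr 1; ring
  have h3 := Real.add_one_le_exp (-(b - a))
  have h4 : Real.exp (-a) ≤ 1 := Real.exp_le_one_iff.2 (by linarith)
  have h5 := Real.exp_pos (-a)
  rw [abs_of_nonneg (by linarith), abs_of_nonpos (by linarith), h2]
  nlinarith

/-- the probability that `S` is untouched -/
def pr (ε D : ℝ) (E : Finset (Finset α)) (S : Finset α) : ℝ :=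
  Real.exp (-(ε / D * #(touch E S)))

lemma pr_close (E : Finset (Finset α)) (V S : Finset α) (hS : S ⊆ V) (ε D κ : ℝ) (hε : 0 ≤ ε)
    (hD : 0 < D) (hκ : ∀ v ∈ V, ∀ w ∈ V, v ≠ w → (codeg E v w : ℝ) ≤ κ) (hκ0 : 0 ≤ κ) :
    |pr ε D E S - Real.exp (-ε) ^ #S| ≤ ε * (∑ w ∈ S, dev E D w + (#S : ℝ) ^ 2 * (κ / D)) := by
  have h1 : Real.exp (-ε) ^ #S = Real.exp (-(ε * #S)) := by
    rw [← Real.exp_nat_mul]; congr 1; ring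
  rw [h1, pr]
  refine (abs_exp_sub (by positivity) (by positivity)).trans ?_
  have h2 : ε / D * #(touch E S) - ε * #S = ε * ((#(touch E S) - #S * D) / D) := by
    field_simp
  rw [h2, abs_mul, abs_of_nonneg hε]
  apply mul_le_mul_of_nonneg_left _ hε
  have h3 : ∑ w ∈ S, dev E D w + (#S : ℝ) ^ 2 * (κ / D)
      = (∑ w ∈ S, |(deg E w : ℝ) - D| + (#S : ℝ) ^ 2 * κ) / D := by
    simp only [dev]; rw [← sum_div]; ring
  rw [h3, abs_div, abs_of_pos hD]
  apply div_le_div_of_nonneg_right _ hD.le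
  have h4 : (#(touch E S) : ℝ) ≤ ∑ w ∈ S, (deg E w : ℝ) := by exact_mod_cast touch_le E S
  have h5 : ∑ w ∈ S, (deg E w : ℝ) ≤ #(touch E S) + ∑ z ∈ S.offDiag, (codeg E z.1 z.2 : ℝ) := by
    exact_mod_cast le_touch E S
  have h6 : ∑ z ∈ S.offDiag, (codeg E z.1 z.2 : ℝ) ≤ (#S : ℝ) ^ 2 * κ := by
    calc _ ≤ ∑ z ∈ S.offDiag, κ := by
          apply sum_le_sum
          intro z hz
          rw [mem_offDiag] at hz
          exact hκ _ (hS hz.1) _ (hS hz.2.1) hz.2.2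
      _ = #(S.offDiag) * κ := by simp
      _ ≤ _ := by
          apply mul_le_mul_of_nonneg_right _ hκ0
          rw [offDiag_card, sq]
          exact_mod_cast Nat.sub_le _ _
  have h7 : ∑ w ∈ S, (deg E w : ℝ) - #S * D = ∑ w ∈ S, ((deg E w : ℝ) - D) := by
    rw [sum_sub_distrib]; simp
  have h8 := abs_sum_le_sum_abs (fun w => (deg E w : ℝ) - D) S
  rw [← h7] at h8
  have := abs_le.1 h8
  have h9 : 0 ≤ (#S : ℝ) ^ 2 * κ := by positivity
  rw [abs_le]; constructor <;> linarith

lemma pr_le_one (E : Finset (Finset α)) (S : Finset α) (ε D : ℝ) (hε : 0 ≤ ε) (hD : 0 < D) :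
    pr ε D E S ≤ 1 := by
  rw [pr, Real.exp_le_one_iff]
  have : 0 ≤ ε / D * #(touch E S) := by positivity
  linarith

/-- indicator that `S` is untouched by `X` -/
def Ind (X : Finset (Finset α)) (S : Finset α) : ℝ := if ∀ f ∈ X, Disjoint f S then 1 else 0

lemma Ex_Ind (E : Finset (Finset α)) (S : Finset α) (ε D : ℝ) :
    Ex (1 - Real.exp (-(ε / D))) E (fun X => Ind X S) = pr ε D E S := by
  have : Ex (1 - Real.exp (-(ε / D))) E (fun X => Ind X S)
      = Ex (1 - Real.exp (-(ε / D))) E (fun X => if Disjoint X (touch E S) then 1 else 0) := by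
    apply Ex_congr
    intro X hX
    unfold Ind
    congr 1
    rw [eq_iff_iff, disjoint_left]
    apply forall_congr'; intro f
    apply forall_congr'; intro hf
    simp [touch, hX hf]
  rw [this, Ex_disj _ _ (touch E S) (filter_subset _ _), pr, sub_sub_cancel, ← Real.exp_nat_mul]
  congr 1; ring

lemma bad_count (E : Finset (Finset α)) (V : Finset α) (κ : ℝ) (k : ℕ)
    (hκ : ∀ v ∈ V, ∀ w ∈ V, v ≠ w → (codeg E v w : ℝ) ≤ κ) (hκ0 : 0 ≤ κ)
    (hE : ∀ e ∈ E, e ⊆ V ∧ #e = k) (v : α) (hv : v ∈ V) (e : Finset α) (he : e ∈ E) :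
    ∑ f ∈ E with v ∈ f, (if 2 ≤ #(e ∩ f) then (1 : ℝ) else 0) ≤ k * κ := by
  rw [← sum_filter, filter_filter, sum_const, nsmul_eq_mul, mul_one]
  have h1 : E.filter (fun f => v ∈ f ∧ 2 ≤ #(e ∩ f)) ⊆
      (e.erase v).biUnion (fun w => {f ∈ E | v ∈ f ∧ w ∈ f}) := by
    intro f hf
    simp only [mem_filter] at hf
    obtain ⟨h1, h2, h3⟩ := hf
    obtain ⟨w, hw, hwv⟩ := exists_mem_ne (by omega : 1 < #(e ∩ f)) v
    simp only [mem_inter] at hw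
    simp only [mem_biUnion, mem_erase, mem_filter]
    exact ⟨w, ⟨hwv, hw.1⟩, h1, h2, hw.2⟩
  have h2 : (#(E.filter (fun f => v ∈ f ∧ 2 ≤ #(e ∩ f))) : ℝ) ≤ ∑ w ∈ e.erase v, (codeg E v w : ℝ) := by
    exact_mod_cast (card_le_card h1).trans card_biUnion_le
  refine h2.trans ?_
  calc _ ≤ ∑ w ∈ e.erase v, κ := by
        apply sum_le_sum
        intro w hw
        rw [mem_erase] at hw
        exact hκ v hv w ((hE e he).1 hw.2) hw.1.symm
    _ = #(e.erase v) * κ := by simp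
    _ ≤ _ := by
        apply mul_le_mul_of_nonneg_right _ hκ0
        have := card_erase_le (s := e) (a := v)
        rw [(hE e he).2] at this
        exact_mod_cast this

lemma pr_union (E : Finset (Finset α)) (V : Finset α) (ε D κ : ℝ) (k : ℕ) (hε : 0 ≤ ε)
    (hD : 0 < D) (hκ : ∀ v ∈ V, ∀ w ∈ V, v ≠ w → (codeg E v w : ℝ) ≤ κ) (hκ0 : 0 ≤ κ)
    (hE : ∀ e ∈ E, e ⊆ V ∧ #e = k) (v : α) (e f : Finset α) (he : e ∈ E)
    (hf : f ∈ E) (hve : v ∈ e) (hvf : v ∈ f) :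
    pr ε D E (e ∪ f) ≤ Real.exp (-ε) ^ (2 * k - 1) +
      ε * (∑ w ∈ e, dev E D w + ∑ w ∈ f, dev E D w + 4 * (k : ℝ) ^ 2 * (κ / D)) +
      (if 2 ≤ #(e ∩ f) then (1 : ℝ) else 0) := by
  have hdev : ∀ w, 0 ≤ dev E D w := fun w => by unfold dev; positivity
  have hs1 : 0 ≤ ∑ w ∈ e, dev E D w := sum_nonneg fun w _ => hdev w
  have hs2 : 0 ≤ ∑ w ∈ f, dev E D w := sum_nonneg fun w _ => hdev w
  have hk : 0 ≤ 4 * (k : ℝ) ^ 2 * (κ / D) := by positivity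
  have hq : 0 ≤ Real.exp (-ε) ^ (2 * k - 1) := by positivity
  have hcard := card_union_add_card_inter e f
  rw [(hE e he).2, (hE f hf).2] at hcard
  split_ifs with h
  · have := pr_le_one E (e ∪ f) ε D hε hD
    have : 0 ≤ ε * (∑ w ∈ e, dev E D w + ∑ w ∈ f, dev E D w + 4 * (k : ℝ) ^ 2 * (κ / D)) := by
      positivity
    linarith
  · have h1 : 0 < #(e ∩ f) := card_pos.2 ⟨v, mem_inter.2 ⟨hve, hvf⟩⟩
    have h2 : #(e ∪ f) = 2 * k - 1 := by omega
    have h3 := pr_close E V (e ∪ f) (union_subset (hE e he).1 (hE f hf).1) ε D κ hε hD hκ hκ0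
    rw [h2] at h3
    have h4 := (abs_le.1 h3).2
    have h5 : ∑ w ∈ e ∪ f, dev E D w ≤ ∑ w ∈ e, dev E D w + ∑ w ∈ f, dev E D w := by
      rw [← sum_union_inter]
      have : 0 ≤ ∑ w ∈ e ∩ f, dev E D w := sum_nonneg fun w _ => hdev w
      linarith
    have h6 : ((2 * k - 1 : ℕ) : ℝ) ^ 2 ≤ 4 * (k : ℝ) ^ 2 := by
      have : ((2 * k - 1 : ℕ) : ℝ) ≤ 2 * k := by exact_mod_cast Nat.sub_le _ _
      have h0 : (0 : ℝ) ≤ ((2 * k - 1 : ℕ) : ℝ) := by positivity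
      nlinarith
    have h7 : ((2 * k - 1 : ℕ) : ℝ) ^ 2 * (κ / D) ≤ 4 * (k : ℝ) ^ 2 * (κ / D) :=
      mul_le_mul_of_nonneg_right h6 (by positivity)
    have h8 := mul_le_mul_of_nonneg_left (add_le_add h5 h7) hε
    linarith

/-- second moment at a vertex -/
def T (E X : Finset (Finset α)) (D' : ℝ) (v : α) : ℝ :=
  ∑ e ∈ E with v ∈ e, ∑ f ∈ E with v ∈ f, Ind X (e ∪ f)
    - 2 * D' * ∑ e ∈ E with v ∈ e, Ind X e + D' ^ 2 * Ind X {v}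

lemma T_eq (E X : Finset (Finset α)) (D' : ℝ) (v : α) :
    T E X D' v = if ∀ f ∈ X, v ∉ f then
      ((deg {e ∈ E | ∀ f ∈ X, Disjoint f e} v : ℝ) - D') ^ 2 else 0 := by
  have h1 : ∀ e f : Finset α, Ind X (e ∪ f) = Ind X e * Ind X f := by
    intro e f
    unfold Ind
    simp only [disjoint_union_right]
    by_cases h1 : ∀ g ∈ X, Disjoint g e <;> by_cases h2 : ∀ g ∈ X, Disjoint g f
    · rw [if_pos h1, if_pos h2, if_pos (fun g hg => ⟨h1 g hg, h2 g hg⟩)]; ring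
    · rw [if_neg h2, if_neg (fun h => h2 fun g hg => (h g hg).2)]; ring
    · rw [if_neg h1, if_neg (fun h => h1 fun g hg => (h g hg).1)]; ring
    · rw [if_neg h2, if_neg (fun h => h2 fun g hg => (h g hg).2)]; ring
  have h2 : (deg {e ∈ E | ∀ f ∈ X, Disjoint f e} v : ℝ) = ∑ e ∈ E with v ∈ e, Ind X e := by
    unfold deg Ind
    rw [← sum_filter, filter_filter, filter_filter, sum_const, nsmul_eq_mul, mul_one]
    simp only [and_comm]
  have h3 : Ind X {v} = if ∀ f ∈ X, v ∉ f then 1 else 0 := by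
    unfold Ind; simp
  have h4 : ∑ e ∈ E with v ∈ e, ∑ f ∈ E with v ∈ f, Ind X (e ∪ f)
      = (∑ e ∈ E with v ∈ e, Ind X e) ^ 2 := by
    rw [sq, sum_mul_sum]; simp only [h1]
  rw [T, h4, h2, h3]
  split_ifs with h
  · ring
  · have : ∑ e ∈ E with v ∈ e, Ind X e = 0 := by
      apply sum_eq_zero
      intro e he
      unfold Ind
      rw [if_neg]
      intro h'
      apply h
      intro f hf hvf
      exact disjoint_left.1 (h' f hf) hvf (mem_filter.1 he).2
    rw [this]; ring

lemma Ex_T (E : Finset (Finset α)) (ε D D' : ℝ) (v : α) :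
    Ex (1 - Real.exp (-(ε / D))) E (fun X => T E X D' v) =
    ∑ e ∈ E with v ∈ e, ∑ f ∈ E with v ∈ f, pr ε D E (e ∪ f)
    - 2 * D' * ∑ e ∈ E with v ∈ e, pr ε D E e + D' ^ 2 * pr ε D E {v} := by
  unfold T
  rw [Ex_add, Ex_sub, Ex_mul, Ex_mul, Ex_sum, Ex_sum, Ex_Ind]
  simp only [Ex_sum, Ex_Ind]

lemma alg_step (S1 S2 P q z x r Y D A ε d k κ : ℝ) (hε : 0 ≤ ε) (hε1 : ε ≤ 1) (hA : 1 ≤ A)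
    (hD : 0 < D) (hq0 : 0 ≤ q) (hq1 : q ≤ 1) (hz0 : 0 ≤ z) (hz1 : z ≤ 1) (hx0 : 0 ≤ x)
    (hr0 : 0 ≤ r) (hκr : κ = r * D) (hY0 : 0 ≤ Y) (hd0 : 0 ≤ d) (hk0 : 0 ≤ k)
    (hdeg : d ≤ A * D) (h4 : |d - D| = x * D)
    (h1 : S1 ≤ d ^ 2 * (z * z * q) + ε * (2 * d * Y + d ^ 2 * (4 * k ^ 2 * r)) + d * (k * κ))
    (h2 : d * (z * q) - ε * (Y + d * (k ^ 2 * r)) ≤ S2)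
    (h3 : P ≤ q + ε * (x + r)) :
    S1 - 2 * (D * z) * S2 + (D * z) ^ 2 * P ≤
      D ^ 2 * ((A + 2) * x + (4 * A ^ 2 * k ^ 2 + A * k + 2 * A * k ^ 2 + 1) * r)
      + (2 * A + 2) * D * Y := by
  subst hκr
  have hAD : 0 ≤ A * D := by positivity
  have hxd : (d - D) ^ 2 ≤ D ^ 2 * ((A + 1) * x) := by
    have h5 : |d - D| ≤ (A + 1) * D := by
      rw [abs_le]; constructor <;> linarith
    calc (d - D) ^ 2 = |d - D| * |d - D| := by rw [← sq, sq_abs]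
      _ ≤ ((A + 1) * D) * (x * D) := by
          rw [← h4]; exact mul_le_mul_of_nonneg_right h5 (abs_nonneg _)
      _ = _ := by ring
  have h2' := mul_le_mul_of_nonneg_left h2 (by positivity : 0 ≤ 2 * (D * z))
  have h3' := mul_le_mul_of_nonneg_left h3 (by positivity : 0 ≤ (D * z) ^ 2)
  have hzz : z * z ≤ 1 := mul_le_one₀ hz1 hz0 hz1
  have hzzq : z * z * q ≤ 1 := mul_le_one₀ hzz hq0 hq1
  have m0 : z * z * q * (d - D) ^ 2 ≤ (d - D) ^ 2 := mul_le_of_le_one_left (sq_nonneg _) hzzq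
  have hεd : ε * d ≤ 1 * (A * D) := mul_le_mul hε1 hdeg hd0 zero_le_one
  have m1 : ε * d * (2 * Y) ≤ 1 * (A * D) * (2 * Y) :=
    mul_le_mul_of_nonneg_right hεd (by positivity)
  have m2 : ε * d ^ 2 * (4 * k ^ 2 * r) ≤ 1 * (A * D) ^ 2 * (4 * k ^ 2 * r) := by
    have h6 : d ^ 2 ≤ (A * D) ^ 2 := pow_le_pow_left₀ hd0 hdeg 2
    have : ε * d ^ 2 ≤ 1 * (A * D) ^ 2 := mul_le_mul hε1 h6 (by positivity) zero_le_one
    exact mul_le_mul_of_nonneg_right this (by positivity)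
  have m3 : d * (k * (r * D)) ≤ A * D * (k * (r * D)) :=
    mul_le_mul_of_nonneg_right hdeg (by positivity)
  have hzε : z * ε ≤ 1 := mul_le_one₀ hz1 hε hε1
  have m4 : 2 * D * (z * ε * (Y + d * (k ^ 2 * r))) ≤
      2 * D * (1 * (Y + A * D * (k ^ 2 * r))) := by
    have h7 : Y + d * (k ^ 2 * r) ≤ Y + A * D * (k ^ 2 * r) := by
      have := mul_le_mul_of_nonneg_right hdeg (by positivity : 0 ≤ (k ^ 2 * r))
      linarith
    have h8 := mul_le_mul hzε h7 (by positivity) zero_le_one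
    exact mul_le_mul_of_nonneg_left h8 (by positivity : 0 ≤ 2 * D)
  have m5 : z * z * ε * (D ^ 2 * (x + r)) ≤ D ^ 2 * (x + r) :=
    mul_le_of_le_one_left (by positivity) (mul_le_one₀ hzz hε hε1)
  linarith

lemma Ex_T_le (E : Finset (Finset α)) (V : Finset α) (ε D κ A : ℝ) (k : ℕ) (hε : 0 ≤ ε)
    (hε1 : ε ≤ 1) (hk : 1 ≤ k) (hA : 1 ≤ A)
    (hD : 0 < D) (hκ : ∀ v ∈ V, ∀ w ∈ V, v ≠ w → (codeg E v w : ℝ) ≤ κ) (hκ0 : 0 ≤ κ)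
    (hE : ∀ e ∈ E, e ⊆ V ∧ #e = k) (v : α) (hv : v ∈ V) (hdeg : (deg E v : ℝ) ≤ A * D) :
    Ex (1 - Real.exp (-(ε / D))) E (fun X => T E X (D * Real.exp (-ε) ^ (k - 1)) v) ≤
      D ^ 2 * ((A + 2) * dev E D v + (4 * A ^ 2 * k ^ 2 + A * k + 2 * A * k ^ 2 + 1) * (κ / D))
      + (2 * A + 2) * D * ∑ e ∈ E with v ∈ e, ∑ w ∈ e, dev E D w := by
  rw [Ex_T]
  set q := Real.exp (-ε) with hq
  have hq0 : 0 ≤ q := (Real.exp_pos _).le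
  have hq1 : q ≤ 1 := Real.exp_le_one_iff.2 (by linarith)
  set d : ℝ := (deg E v : ℝ) with hd
  have hd0 : 0 ≤ d := by positivity
  set r : ℝ := κ / D with hr
  have hr0 : 0 ≤ r := by positivity
  have hκr : κ = r * D := by rw [hr]; field_simp
  set Y := ∑ e ∈ E with v ∈ e, ∑ w ∈ e, dev E D w with hY
  have hdev : ∀ w, 0 ≤ dev E D w := fun w => by unfold dev; positivity
  have hY0 : 0 ≤ Y := sum_nonneg fun e _ => sum_nonneg fun w _ => hdev w
  have hcard : ((#{e ∈ E | v ∈ e} : ℕ) : ℝ) = d := rfl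
  have h1 : ∑ e ∈ E with v ∈ e, ∑ f ∈ E with v ∈ f, pr ε D E (e ∪ f) ≤
      d ^ 2 * q ^ (2 * k - 1) + ε * (2 * d * Y + d ^ 2 * (4 * (k : ℝ) ^ 2 * r)) + d * (k * κ) := by
    calc _ ≤ ∑ e ∈ E with v ∈ e, ∑ f ∈ E with v ∈ f, (q ^ (2 * k - 1) +
            ε * (∑ w ∈ e, dev E D w + ∑ w ∈ f, dev E D w + 4 * (k : ℝ) ^ 2 * r) +
            (if 2 ≤ #(e ∩ f) then (1 : ℝ) else 0)) := by
          apply sum_le_sum; intro e he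
          apply sum_le_sum; intro f hf
          rw [mem_filter] at he hf
          exact pr_union E V ε D κ k hε hD hκ hκ0 hE v e f he.1 hf.1 he.2 hf.2
      _ ≤ ∑ e ∈ E with v ∈ e, (d * q ^ (2 * k - 1) +
            ε * (d * ∑ w ∈ e, dev E D w + Y + d * (4 * (k : ℝ) ^ 2 * r)) + k * κ) := by
          apply sum_le_sum; intro e he
          rw [mem_filter] at he
          rw [sum_add_distrib, sum_add_distrib, ← mul_sum, sum_add_distrib, sum_add_distrib]
          simp only [sum_const, nsmul_eq_mul, hcard]
          have := bad_count E V κ k hκ hκ0 hE v hv e he.1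
          linarith
      _ = _ := by
          simp only [sum_add_distrib, ← mul_sum, sum_const, nsmul_eq_mul, hcard]
          rw [← hY]
          ring
  have h2 : d * q ^ k - ε * (Y + d * ((k : ℝ) ^ 2 * r)) ≤ ∑ e ∈ E with v ∈ e, pr ε D E e := by
    calc _ = ∑ e ∈ E with v ∈ e, (q ^ k - ε * (∑ w ∈ e, dev E D w + (k : ℝ) ^ 2 * r)) := by
          rw [sum_sub_distrib, ← mul_sum, sum_add_distrib]
          simp only [sum_const, nsmul_eq_mul, hcard]
          ring
      _ ≤ _ := by
          apply sum_le_sum; intro e he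
          rw [mem_filter] at he
          have := pr_close E V e (hE e he.1).1 ε D κ hε hD hκ hκ0
          rw [(hE e he.1).2] at this
          have := (abs_le.1 this).1
          linarith
  have h3 : pr ε D E {v} ≤ q + ε * (dev E D v + r) := by
    have := pr_close E V {v} (by simpa using hv) ε D κ hε hD hκ hκ0
    simp at this
    have := (abs_le.1 this).2
    linarith
  have hz0 : 0 ≤ q ^ (k - 1) := by positivity
  have hz1 : q ^ (k - 1) ≤ 1 := pow_le_one₀ hq0 hq1
  have e1 : q ^ k = q ^ (k - 1) * q := by rw [← pow_succ]; congr 1; omega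
  have e2 : q ^ (2 * k - 1) = q ^ (k - 1) * q ^ (k - 1) * q := by
    rw [← pow_add, ← pow_succ]; congr 1; omega
  rw [e2] at h1
  rw [e1] at h2
  refine alg_step _ _ _ q (q ^ (k - 1)) (dev E D v) r Y D A ε d k κ hε hε1 hA hD hq0 hq1 hz0 hz1
    (hdev v) hr0 hκr hY0 hd0 (by positivity) hdeg ?_ h1 h2 h3
  rw [dev, div_mul_cancel₀ _ hD.ne']

lemma sum_T_le (E : Finset (Finset α)) (V : Finset α) (ε D κ A : ℝ) (k : ℕ) (hε : 0 ≤ ε)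
    (hε1 : ε ≤ 1) (hk : 1 ≤ k) (hA : 1 ≤ A)
    (hD : 0 < D) (hκ : ∀ v ∈ V, ∀ w ∈ V, v ≠ w → (codeg E v w : ℝ) ≤ κ) (hκ0 : 0 ≤ κ)
    (hE : ∀ e ∈ E, e ⊆ V ∧ #e = k) (hdeg : ∀ v ∈ V, (deg E v : ℝ) ≤ A * D) :
    Ex (1 - Real.exp (-(ε / D))) E
        (fun X => ∑ v ∈ V, T E X (D * Real.exp (-ε) ^ (k - 1)) v) ≤
      D ^ 2 * (((A + 2) + (2 * A + 2) * (k * A)) * ∑ v ∈ V, dev E D v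
        + (4 * A ^ 2 * k ^ 2 + A * k + 2 * A * k ^ 2 + 1) * (κ / D) * #V) := by
  rw [Ex_sum]
  have hdev : ∀ w, 0 ≤ dev E D w := fun w => by unfold dev; positivity
  refine (sum_le_sum fun v hv =>
    Ex_T_le E V ε D κ A k hε hε1 hk hA hD hκ hκ0 hE v hv (hdeg v hv)).trans ?_
  rw [sum_add_distrib, ← mul_sum, sum_add_distrib, ← mul_sum, ← mul_sum (s := V) (a := (2 * A + 2) * D),
    sum_deg_comm E V (fun e he => (hE e he).1) (fun _ e => ∑ w ∈ e, dev E D w)]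
  have h1 : ∑ e ∈ E, ∑ v ∈ e, ∑ w ∈ e, dev E D w ≤ k * (A * D) * ∑ v ∈ V, dev E D v := by
    calc _ = ∑ e ∈ E, ∑ w ∈ e, k * dev E D w := by
          apply sum_congr rfl; intro e he
          rw [sum_const, (hE e he).2, nsmul_eq_mul, mul_sum]
      _ = ∑ w ∈ V, ∑ e ∈ E with w ∈ e, k * dev E D w :=
          (sum_deg_comm E V (fun e he => (hE e he).1) (fun w _ => k * dev E D w)).symm
      _ = ∑ w ∈ V, (deg E w : ℝ) * (k * dev E D w) := by
          simp only [sum_const, nsmul_eq_mul]; rfl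
      _ ≤ ∑ w ∈ V, (A * D) * (k * dev E D w) := by
          apply sum_le_sum; intro w hw
          exact mul_le_mul_of_nonneg_right (hdeg w hw) (mul_nonneg (by positivity) (hdev w))
      _ = _ := by simp only [← mul_sum]; ring
  have h2 := mul_le_mul_of_nonneg_left h1 (by positivity : 0 ≤ (2 * A + 2) * D)
  simp only [sum_const, nsmul_eq_mul] at h2 ⊢
  linarith


/-- waste bound -/
def W (E : Finset (Finset α)) (X : Finset (Finset α)) : ℝ :=
  ∑ e ∈ E, ∑ f ∈ E with f ≠ e ∧ ¬ Disjoint e f, if e ∈ X ∧ f ∈ X then (1 : ℝ) else 0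

lemma Ex_W_le (E : Finset (Finset α)) (V : Finset α) (p : ℝ) (hE : ∀ e ∈ E, e ⊆ V) :
    Ex p E (fun X => W E X) ≤ p ^ 2 * ∑ v ∈ V, (deg E v : ℝ) ^ 2 := by
  unfold W
  rw [Ex_sum]
  have h1 : ∀ e ∈ E, Ex p E (fun X => ∑ f ∈ E with f ≠ e ∧ ¬ Disjoint e f,
      if e ∈ X ∧ f ∈ X then (1 : ℝ) else 0) ≤
      ∑ f ∈ E, ∑ v ∈ V, p ^ 2 * ((if v ∈ e then 1 else 0) * (if v ∈ f then 1 else 0)) := by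
    intro e he
    rw [Ex_sum, sum_filter]
    apply sum_le_sum
    intro f hf
    have hnn : ∀ v ∈ V, 0 ≤ p ^ 2 * ((if v ∈ e then (1 : ℝ) else 0) * (if v ∈ f then 1 else 0)) := by
      intro v _
      have : (0 : ℝ) ≤ (if v ∈ e then (1 : ℝ) else 0) * (if v ∈ f then 1 else 0) := by
        split_ifs <;> simp
      positivity
    split_ifs with h
    · rw [Ex_pair p E he hf h.1.symm]
      obtain ⟨v, hve, hvf⟩ := not_disjoint_iff.1 h.2
      refine le_trans ?_ (single_le_sum hnn (hE e he hve))
      simp [hve, hvf]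
    · exact sum_nonneg hnn
  refine (sum_le_sum h1).trans (le_of_eq ?_)
  have h2 : ∀ v, (deg E v : ℝ) = ∑ e ∈ E, if v ∈ e then (1 : ℝ) else 0 := by
    intro v; simp [deg]
  rw [sum_congr rfl fun e _ => sum_comm, sum_comm, mul_sum]
  apply sum_congr rfl
  intro v _
  rw [h2, sq (∑ e ∈ E, _), sum_mul_sum, mul_sum]
  apply sum_congr rfl
  intro e _
  rw [mul_sum]

lemma amgm_aux (t σ : ℝ) (hσ0 : 0 < σ) : t ≤ σ + t ^ 2 / σ := by
  have h3 : σ + t ^ 2 / σ - t = (t ^ 2 + σ ^ 2 - t * σ) / σ := by field_simp; ring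
  have h4 : 0 ≤ (t ^ 2 + σ ^ 2 - t * σ) / σ := by
    apply div_nonneg _ hσ0.le
    nlinarith [sq_nonneg (t - σ), sq_nonneg t, sq_nonneg σ]
  linarith

lemma combine (E : Finset (Finset α)) (V : Finset α) (k : ℕ) (hE : ∀ e ∈ E, e ⊆ V ∧ #e = k)
    (X : Finset (Finset α)) (hX : X ⊆ E) (N : Finset (Finset α))
    (hN : N ⊆ {e ∈ E | ∀ f ∈ X, Disjoint f e})
    (hN' : ∀ e ∈ N, ∀ f ∈ N, e ≠ f → Disjoint e f) :
    ∃ M ⊆ E, (∀ e ∈ M, ∀ f ∈ M, e ≠ f → Disjoint e f) ∧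
      (#(V \ M.biUnion id) : ℝ) ≤ k * W E X
        + #({v ∈ V | ∀ f ∈ X, v ∉ f} \ N.biUnion id) := by
  set M₀ := {e ∈ X | ∀ f ∈ X, f ≠ e → Disjoint e f} with hM₀
  refine ⟨M₀ ∪ N, ?_, ?_, ?_⟩
  · intro e he
    rcases mem_union.1 he with h | h
    · exact hX (mem_filter.1 h).1
    · exact (mem_filter.1 (hN h)).1
  · intro e he f hf hef
    rcases mem_union.1 he with h | h <;> rcases mem_union.1 hf with h' | h'
    · exact (mem_filter.1 h).2 f (mem_filter.1 h').1 hef.symm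
    · exact (mem_filter.1 (hN h')).2 e (mem_filter.1 h).1
    · exact ((mem_filter.1 (hN h)).2 f (mem_filter.1 h').1).symm
    · exact hN' e h f h' hef
  · have h1 : V \ (M₀ ∪ N).biUnion id ⊆ (X \ M₀).biUnion id ∪
        ({v ∈ V | ∀ f ∈ X, v ∉ f} \ N.biUnion id) := by
      intro v hv
      simp only [mem_sdiff, mem_biUnion, id, not_exists, not_and, mem_union, mem_filter] at hv ⊢
      by_cases h : ∀ f ∈ X, v ∉ f
      · right; exact ⟨⟨hv.1, h⟩, fun f hf => hv.2 f (Or.inr hf)⟩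
      · left
        push Not at h
        obtain ⟨f, hf, hvf⟩ := h
        exact ⟨f, ⟨hf, fun hfM => hv.2 f (Or.inl hfM) hvf⟩, hvf⟩
    have h2 := (card_le_card h1).trans (card_union_le _ _)
    have h3 : #((X \ M₀).biUnion id) ≤ #(X \ M₀) * k := by
      apply card_biUnion_le_card_mul
      intro e he
      exact (hE e (hX (mem_sdiff.1 he).1)).2.le
    have h4 : (#(X \ M₀) : ℝ) ≤ W E X := by
      unfold W
      have h5 : (#(X \ M₀) : ℝ) = ∑ e ∈ E, if e ∈ X \ M₀ then (1 : ℝ) else 0 := by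
        rw [← sum_filter, sum_const, nsmul_eq_mul, mul_one]
        congr 2
        ext e
        simp only [mem_filter]
        exact ⟨fun h => ⟨hX (mem_sdiff.1 h).1, h⟩, fun h => h.2⟩
      rw [h5]
      apply sum_le_sum
      intro e he
      have hnn : ∀ f ∈ {f ∈ E | f ≠ e ∧ ¬ Disjoint e f},
          (0 : ℝ) ≤ if e ∈ X ∧ f ∈ X then (1 : ℝ) else 0 := by
        intro f _; split_ifs <;> simp
      split_ifs with h
      · rw [mem_sdiff, hM₀, mem_filter] at h
        obtain ⟨h6, h7⟩ := h
        have h8 : ∃ f ∈ X, f ≠ e ∧ ¬ Disjoint e f := by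
          by_contra! h9
          exact h7 ⟨h6, h9⟩
        obtain ⟨f, hf, hfe, hd⟩ := h8
        refine le_trans ?_ (single_le_sum hnn (mem_filter.2 ⟨hX hf, hfe, hd⟩))
        simp [h6, hf]
      · exact sum_nonneg hnn
    have h2' : (#(V \ (M₀ ∪ N).biUnion id) : ℝ) ≤ #((X \ M₀).biUnion id)
        + #({v ∈ V | ∀ f ∈ X, v ∉ f} \ N.biUnion id) := by exact_mod_cast h2
    have h3' : (#((X \ M₀).biUnion id) : ℝ) ≤ #(X \ M₀) * k := by exact_mod_cast h3
    have h10 := mul_le_mul_of_nonneg_right h4 (by positivity : (0 : ℝ) ≤ k)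
    linarith

end Basic

/-- the inductive property -/
def Q (k : ℕ) (u : ℝ) : Prop :=
  ∀ A τ : ℝ, 1 ≤ A → 0 < τ → ∃ C : ℝ, 0 ≤ C ∧
    ∀ (α : Type) [DecidableEq α] (V : Finset α) (E : Finset (Finset α)) (D κ M : ℝ), 0 < D →
      (∀ e ∈ E, e ⊆ V ∧ #e = k) → (∀ v ∈ V, (deg E v : ℝ) ≤ A * D) →
      (∀ v ∈ V, ∀ w ∈ V, v ≠ w → (codeg E v w : ℝ) ≤ κ) → 0 ≤ κ → (#V : ℝ) ≤ M →
      ∃ N ⊆ E, (∀ e ∈ N, ∀ f ∈ N, e ≠ f → Disjoint e f) ∧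
        (#(V \ N.biUnion id) : ℝ) ≤ u * #V + τ * M + C * ∑ v ∈ V, dev E D v + C * (κ / D) * M

lemma Q_one (k : ℕ) : Q k 1 := by
  intro A τ _ hτ
  refine ⟨0, le_rfl, ?_⟩
  intro α _ V E D κ M _ _ _ _ _ hM
  refine ⟨∅, by simp, by simp, ?_⟩
  have : (0 : ℝ) ≤ #V := by positivity
  have : 0 ≤ τ * M := mul_nonneg hτ.le (by linarith)
  simp
  linarith

set_option maxHeartbeats 1000000 in
lemma Q_step (k : ℕ) (hk : 1 ≤ k) (u ε : ℝ) (hu : 0 ≤ u) (hε : 0 < ε) (hε1 : ε ≤ 1)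
    (hQ : Q k u) : Q k (u * (1 - ε / 2) + k * ε ^ 2) := by
  intro A τ hA hτ
  set z := Real.exp (-ε) ^ (k - 1) with hz
  have hz0 : 0 < z := by positivity
  have hz1 : z ≤ 1 := pow_le_one₀ (Real.exp_pos _).le (Real.exp_le_one_iff.2 (by linarith))
  obtain ⟨C', hC', H⟩ := hQ (A / z) (τ / 2) ((one_le_div hz0).2 (by linarith)) (by positivity)
  set σ := τ / (2 * (C' + 1)) with hσ
  have hσ0 : 0 < σ := by positivity
  have hσ1 : C' * σ ≤ τ / 2 := by
    rw [hσ, mul_div_assoc', div_le_div_iff₀ (by positivity) (by norm_num)]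
    nlinarith
  set K1 := (A + 2) + (2 * A + 2) * (k * A) with hK1
  set K2 := 4 * A ^ 2 * k ^ 2 + A * k + 2 * A * k ^ 2 + 1 with hK2
  have hK10 : 0 ≤ K1 := by positivity
  have hK20 : 0 ≤ K2 := by positivity
  set C := k * ε ^ 2 * (A + 1) + u * ε + C' / σ / z ^ 2 * (K1 + K2) + C' / z with hC
  refine ⟨C, by positivity, ?_⟩
  intro α _ V E D κ M hD hE hdeg hκ hκ0 hM
  set p := 1 - Real.exp (-(ε / D)) with hp
  have hεD : 0 < ε / D := by positivity
  have hp0 : 0 ≤ p := by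
    have : Real.exp (-(ε / D)) ≤ 1 := Real.exp_le_one_iff.2 (by linarith)
    linarith
  have hp1 : p ≤ 1 := by have := Real.exp_pos (-(ε / D)); linarith
  have hpε : p ≤ ε / D := by have := Real.add_one_le_exp (-(ε / D)); linarith
  set r := κ / D with hr
  have hr0 : 0 ≤ r := by positivity
  set X1 := ∑ v ∈ V, dev E D v with hX1
  have hdev : ∀ w, 0 ≤ dev E D w := fun w => by unfold dev; positivity
  have hX10 : 0 ≤ X1 := sum_nonneg fun w _ => hdev w
  have hV0 : (0 : ℝ) ≤ #V := by positivity
  have hM0 : 0 ≤ M := by linarith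
  -- the three expectations
  have hW : Ex p E (fun X => W E X) ≤ ε ^ 2 * (#V + (A + 1) * X1) := by
    refine (Ex_W_le E V p fun e he => (hE e he).1).trans ?_
    calc _ ≤ (ε / D) ^ 2 * ∑ v ∈ V, (deg E v : ℝ) ^ 2 := by
          apply mul_le_mul_of_nonneg_right (pow_le_pow_left₀ hp0 hpε 2)
          exact sum_nonneg fun v _ => by positivity
      _ ≤ (ε / D) ^ 2 * ∑ v ∈ V, (D ^ 2 * (1 + (A + 1) * dev E D v)) := by
          apply mul_le_mul_of_nonneg_left _ (by positivity)
          apply sum_le_sum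
          intro v hv
          have h1 := hdeg v hv
          have h2 : |(deg E v : ℝ) - D| = dev E D v * D := by
            rw [dev, div_mul_cancel₀ _ hD.ne']
          have h3 : (deg E v : ℝ) - D ≤ dev E D v * D := h2 ▸ le_abs_self _
          have h4 : (0 : ℝ) ≤ deg E v := by positivity
          have h5 : ((deg E v : ℝ) - D) * (deg E v + D) ≤ (dev E D v * D) * ((A + 1) * D) := by
            apply mul_le_mul h3 (by linarith) (by positivity)
            exact mul_nonneg (hdev v) hD.le
          linarith
      _ = _ := by
          rw [← mul_sum, sum_add_distrib, ← mul_sum]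
          simp only [sum_const, nsmul_eq_mul, mul_one]
          rw [← hX1]
          field_simp
  have hI : Ex p E (fun X => ∑ v ∈ V, Ind X {v}) ≤ (1 - ε / 2) * #V + ε * X1 + ε * r * #V := by
    rw [Ex_sum]
    calc _ ≤ ∑ v ∈ V, ((1 - ε / 2) + ε * dev E D v + ε * r) := by
          apply sum_le_sum
          intro v hv
          rw [hp, Ex_Ind]
          have := pr_close E V {v} (by simpa using hv) ε D κ hε.le hD hκ hκ0
          simp at this
          have h1 := (abs_le.1 this).2
          have h2 : Real.exp (-ε) ≤ 1 - ε / 2 := by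
            rw [Real.exp_neg]
            have h3 := Real.add_one_le_exp ε
            have h4 : (Real.exp ε)⁻¹ ≤ (ε + 1)⁻¹ := inv_anti₀ (by linarith) h3
            refine h4.trans ?_
            rw [inv_le_iff_one_le_mul₀ (by linarith)]
            nlinarith
          linarith
      _ = _ := by
          rw [sum_add_distrib, sum_add_distrib, ← mul_sum]
          simp only [sum_const, nsmul_eq_mul]
          ring
  have hT : Ex p E (fun X => ∑ v ∈ V, T E X (D * z) v) ≤ D ^ 2 * (K1 * X1 + K2 * r * #V) :=
    sum_T_le E V ε D κ A k hε.le hε1 hk hA hD hκ hκ0 hE hdeg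
  set D' := D * z with hD'
  have hD'0 : 0 < D' := by positivity
  obtain ⟨X, hXE, hX⟩ := Ex_exists p E hp0 hp1 (fun X => k * W E X + u * (∑ v ∈ V, Ind X {v})
    + (C' / σ / D' ^ 2) * (∑ v ∈ V, T E X D' v))
  rw [Ex_add, Ex_add, Ex_mul, Ex_mul, Ex_mul] at hX
  set V' := {v ∈ V | ∀ f ∈ X, v ∉ f} with hV'
  set E' := {e ∈ E | ∀ f ∈ X, Disjoint f e} with hE'
  have hV'V : V' ⊆ V := filter_subset _ _
  have hdegle : ∀ v, deg E' v ≤ deg E v := fun v =>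
    card_le_card (filter_subset_filter _ (filter_subset _ _))
  have hcodegle : ∀ v w, codeg E' v w ≤ codeg E v w := fun v w =>
    card_le_card (filter_subset_filter _ (filter_subset _ _))
  have hV'M : (#V' : ℝ) ≤ M := le_trans (by exact_mod_cast card_le_card hV'V) hM
  obtain ⟨N, hNE, hN, hNc⟩ := H α V' E' D' κ M hD'0
    (by
      intro e he
      rw [hE', mem_filter] at he
      refine ⟨?_, (hE e he.1).2⟩
      intro v hv
      rw [hV', mem_filter]
      exact ⟨(hE e he.1).1 hv, fun f hf hvf => disjoint_left.1 (he.2 f hf) hvf hv⟩)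
    (by
      intro v hv
      have h1 : A / z * D' = A * D := by rw [hD']; field_simp
      rw [h1]
      exact le_trans (by exact_mod_cast hdegle v) (hdeg v (hV'V hv)))
    (by
      intro v hv w hw hvw
      exact le_trans (by exact_mod_cast hcodegle v w) (hκ v (hV'V hv) w (hV'V hw) hvw))
    hκ0 hV'M
  obtain ⟨M₁, hM₁E, hM₁, hM₁c⟩ := combine E V k hE X hXE N hNE hN
  refine ⟨M₁, hM₁E, hM₁, ?_⟩
  have hVI : (#V' : ℝ) = ∑ v ∈ V, Ind X {v} := by
    unfold Ind
    rw [← sum_filter, sum_const, nsmul_eq_mul, mul_one, hV']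
    simp
  have hdevT : ∑ v ∈ V', dev E' D' v ≤ σ * M + 1 / σ / D' ^ 2 * ∑ v ∈ V, T E X D' v := by
    have h1 : ∑ v ∈ V, T E X D' v = ∑ v ∈ V', ((deg E' v : ℝ) - D') ^ 2 := by
      rw [hV', sum_filter]
      exact sum_congr rfl fun v _ => T_eq E X D' v
    rw [h1]
    calc _ ≤ ∑ v ∈ V', (σ + 1 / σ / D' ^ 2 * ((deg E' v : ℝ) - D') ^ 2) := by
          apply sum_le_sum
          intro v _
          have h2 : 1 / σ / D' ^ 2 * ((deg E' v : ℝ) - D') ^ 2 = (dev E' D' v) ^ 2 / σ := by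
            rw [dev, div_pow, sq_abs]; field_simp
          rw [h2]
          exact amgm_aux _ _ hσ0
      _ = #V' * σ + 1 / σ / D' ^ 2 * ∑ v ∈ V', ((deg E' v : ℝ) - D') ^ 2 := by
          rw [sum_add_distrib, ← mul_sum]; simp
      _ ≤ _ := by
          have := mul_le_mul_of_nonneg_right hV'M hσ0.le
          linarith
  have hk0 : (0 : ℝ) ≤ k := by positivity
  have g1 := mul_le_mul_of_nonneg_left hW hk0
  have g2 := mul_le_mul_of_nonneg_left hI hu
  have g3 := mul_le_mul_of_nonneg_left hT (by positivity : 0 ≤ C' / σ / D' ^ 2)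
  have g4 := mul_le_mul_of_nonneg_left hdevT hC'
  have g5 : C' / σ / D' ^ 2 * (D ^ 2 * (K1 * X1 + K2 * r * #V)) =
      C' / σ / z ^ 2 * (K1 * X1 + K2 * r * #V) := by
    rw [hD']; field_simp
  have g6 : C' * (κ / D') * M = C' / z * r * M := by
    rw [hD', hr]; field_simp
  have g7 : C' * (1 / σ / D' ^ 2 * ∑ v ∈ V, T E X D' v) =
      C' / σ / D' ^ 2 * ∑ v ∈ V, T E X D' v := by ring
  have g8 := mul_le_mul_of_nonneg_right hσ1 hM0
  rw [g5] at g3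
  rw [g6, hVI] at hNc
  rw [← hV'] at hM₁c
  set L := C' / σ / z ^ 2 with hL
  have hL0 : 0 ≤ L := by positivity
  have hCz : 0 ≤ C' / z := by positivity
  set G := C' / z with hG
  have f1 : r * (#V : ℝ) ≤ r * M := mul_le_mul_of_nonneg_left hM hr0
  have f2 : u * ε * (r * #V) ≤ u * ε * (r * M) := mul_le_mul_of_nonneg_left f1 (by positivity)
  have f3 : L * K2 * (r * #V) ≤ L * K2 * (r * M) := mul_le_mul_of_nonneg_left f1 (by positivity)
  have f4 : 0 ≤ L * K2 * X1 := by positivity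
  have f5 : 0 ≤ L * K1 * (r * M) := by positivity
  have f6 : 0 ≤ G * X1 := by positivity
  have f7 : 0 ≤ k * ε ^ 2 * (A + 1) * (r * M) := by positivity
  rw [hC]
  linarith

lemma Q_iter (k : ℕ) (hk : 1 ≤ k) (ε : ℝ) (hε : 0 < ε) (hε1 : ε ≤ 1) (j : ℕ) :
    Q k ((1 - ε / 2) ^ j + 2 * k * ε) := by
  have h0 : 0 ≤ 1 - ε / 2 := by linarith
  induction j with
  | zero =>
    intro A τ hA hτ
    obtain ⟨C, hC, H⟩ := Q_one k A τ hA hτ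
    refine ⟨C, hC, ?_⟩
    intro α _ V E D κ M hD hE hdeg hκ hκ0 hM
    obtain ⟨N, h1, h2, h3⟩ := H α V E D κ M hD hE hdeg hκ hκ0 hM
    refine ⟨N, h1, h2, h3.trans ?_⟩
    have : 0 ≤ 2 * k * ε * #V := by positivity
    rw [pow_zero]
    linarith
  | succ j ih =>
    have := Q_step k hk _ ε (by positivity) hε hε1 ih
    convert this using 1
    ring

lemma Q_small (k : ℕ) (hk : 1 ≤ k) (u : ℝ) (hu : 0 < u) : ∃ u', 0 ≤ u' ∧ u' ≤ u ∧ Q k u' := by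
  have hk0 : (0 : ℝ) < k := by exact_mod_cast hk
  set ε := min 1 (u / (4 * k)) with hε
  have hε0 : 0 < ε := lt_min one_pos (by positivity)
  have hε1 : ε ≤ 1 := min_le_left _ _
  have h1 : 2 * k * ε ≤ u / 2 := by
    have : ε ≤ u / (4 * k) := min_le_right _ _
    calc 2 * k * ε ≤ 2 * k * (u / (4 * k)) := by gcongr
      _ = u / 2 := by field_simp; ring
  obtain ⟨j, hj⟩ := exists_pow_lt_of_lt_one (by positivity : 0 < u / 2)
    (by linarith : 1 - ε / 2 < 1)
  have h0 : 0 ≤ 1 - ε / 2 := by linarith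
  exact ⟨_, by positivity, by linarith, Q_iter k hk ε hε0 hε1 j⟩


lemma card_super (n m : ℕ) (v : Finset (Fin n)) (hv : #v ≤ m) :
    #{B ∈ powersetCard m (univ : Finset (Fin n)) | v ⊆ B} = (n - #v).choose (m - #v) := by
  have h1 : #(univ \ v) = n - #v := by
    rw [card_sdiff_of_subset (subset_univ _)]; simp
  rw [← h1, ← card_powersetCard]
  apply card_bij' (fun B _ => B \ v) (fun S _ => S ∪ v)
  · intro B hB
    simp only [mem_filter, mem_powersetCard] at hB ⊢
    exact ⟨sdiff_subset_sdiff (subset_univ _) le_rfl, by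
      rw [card_sdiff_of_subset hB.2, hB.1.2]⟩
  · intro S hS
    simp only [mem_filter, mem_powersetCard] at hS ⊢
    refine ⟨⟨subset_univ _, ?_⟩, subset_union_right⟩
    rw [card_union_of_disjoint (subset_sdiff.1 hS.1).2, hS.2]; omega
  · intro B hB
    simp only [mem_filter, mem_powersetCard] at hB
    exact sdiff_union_of_subset hB.2
  · intro S hS
    simp only [mem_powersetCard] at hS
    exact union_sdiff_cancel_right (subset_sdiff.1 hS.1).2

lemma powersetCard_sub {n r : ℕ} (hr : 1 ≤ r) {B B' : Finset (Fin n)} (hB : r ≤ #B)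
    (h : powersetCard r B = powersetCard r B') : B ⊆ B' := by
  intro x hx
  obtain ⟨s, hs1, hs2, hs3⟩ := exists_subsuperset_card_eq (s := {x}) (t := B) (n := r)
    (by simpa using hx) (by simpa using hr) hB
  have : s ∈ powersetCard r B' := by rw [← h, mem_powersetCard]; exact ⟨hs2, hs3⟩
  exact (mem_powersetCard.1 this).1 (hs1 (by simp))

lemma main (r m : ℕ) (hr : 1 ≤ r) (hrm : r < m) (lam : ℝ) (hlam : 0 < lam) :
    ∃ n₀ : ℕ, ∀ n, n₀ < n →
      ∃ D : Finset (Finset (Fin n)), IsSteiner r m n D ∧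
        (1 - lam) * (n.choose r : ℝ) * ((m.choose r : ℝ))⁻¹ ≤ (D.card : ℝ) := by
  set k := m.choose r with hk
  have hk1 : 1 ≤ k := Nat.choose_pos hrm.le
  obtain ⟨u, hu0, hu, hQ⟩ := Q_small k hk1 (lam / 3) (by positivity)
  obtain ⟨C, hC, H⟩ := hQ 1 (lam / 3) le_rfl (by positivity)
  obtain ⟨n₁, hn₁⟩ := exists_nat_ge (3 * C * (m - r) / lam)
  refine ⟨m + n₁, ?_⟩
  intro n hn
  set V := powersetCard r (univ : Finset (Fin n)) with hV
  set P := powersetCard m (univ : Finset (Fin n)) with hP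
  set E := P.image (powersetCard r) with hE
  have hVc : #V = n.choose r := by rw [hV, card_powersetCard]; simp
  have hPc : ∀ B ∈ P, #B = m := fun B hB => (mem_powersetCard.1 hB).2
  have hinj : ∀ B ∈ P, ∀ B' ∈ P, powersetCard r B = powersetCard r B' → B = B' := by
    intro B hB B' hB' h
    exact Subset.antisymm (powersetCard_sub hr (by rw [hPc B hB]; omega) h)
      (powersetCard_sub hr (by rw [hPc B' hB']; omega) h.symm)
  set d := (n - r).choose (m - r) with hd
  set κ := (n - (r + 1)).choose (m - (r + 1)) with hκ
  have hd0 : 0 < d := Nat.choose_pos (by omega)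
  have hd0' : (0 : ℝ) < d := by exact_mod_cast hd0
  have hdκ : (n - r) * κ = (m - r) * d := by
    have h1 : n - r = (n - (r + 1)) + 1 := by omega
    have h2 : m - r = (m - (r + 1)) + 1 := by omega
    rw [hd, hκ]
    rw [h1, h2, Nat.add_one_mul_choose_eq]
    ring_nf
  have hdeg : ∀ v ∈ V, deg E v = d := by
    intro v hv
    have hvc : #v = r := (mem_powersetCard.1 hv).2
    have h1 : ({e ∈ E | v ∈ e} : Finset _) = ({B ∈ P | v ⊆ B}).image (powersetCard r) := by
      rw [hE, filter_image]
      congr 1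
      apply filter_congr
      intro B _
      rw [mem_powersetCard]; simp [hvc]
    rw [deg, h1, card_image_of_injOn, hP, card_super n m v (by omega), hvc]
    intro B hB B' hB' h
    exact hinj B (mem_filter.1 (mem_coe.1 hB)).1 B' (mem_filter.1 (mem_coe.1 hB')).1 h
  have hcodeg : ∀ v ∈ V, ∀ w ∈ V, v ≠ w → codeg E v w ≤ κ := by
    intro v hv w hw hvw
    have hvc : #v = r := (mem_powersetCard.1 hv).2
    have hwc : #w = r := (mem_powersetCard.1 hw).2
    have h1 : r + 1 ≤ #(v ∪ w) := by
      by_contra! h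
      have h2 : v = v ∪ w := eq_of_subset_of_card_le subset_union_left (by omega)
      have h3 : w = v ∪ w := eq_of_subset_of_card_le subset_union_right (by omega)
      exact hvw (h2.trans h3.symm)
    obtain ⟨s, hs, hsc⟩ := exists_subset_card_eq h1
    have h2 : ({e ∈ E | v ∈ e ∧ w ∈ e} : Finset _) ⊆
        ({B ∈ P | s ⊆ B}).image (powersetCard r) := by
      rw [hE, filter_image]
      apply image_subset_image
      intro B hB
      simp only [mem_filter, mem_powersetCard] at hB ⊢
      exact ⟨hB.1, hs.trans (union_subset hB.2.1.1 hB.2.2.1)⟩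
    calc codeg E v w ≤ _ := card_le_card h2
      _ ≤ _ := card_image_le
      _ = κ := by rw [hP, card_super n m s (by omega), hsc]
  obtain ⟨N, hNE, hN, hNc⟩ := H (Finset (Fin n)) V E d κ #V hd0'
    (by
      intro e he
      obtain ⟨B, hB, rfl⟩ := mem_image.1 he
      refine ⟨powersetCard_mono (subset_univ _), ?_⟩
      rw [card_powersetCard, hPc B hB])
    (by intro v hv; rw [hdeg v hv, one_mul])
    (by intro v hv w hw hvw; exact_mod_cast hcodeg v hv w hw hvw)
    (by positivity) le_rfl
  have hdev : ∑ v ∈ V, dev E d v = 0 := by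
    apply sum_eq_zero
    intro v hv
    simp [dev, hdeg v hv]
  rw [hdev, mul_zero, add_zero] at hNc
  have hratio : C * (κ / d) ≤ lam / 3 := by
    have h1 : (((n - r : ℕ) : ℝ)) * κ = ((m - r : ℕ) : ℝ) * d := by exact_mod_cast hdκ
    rw [Nat.cast_sub (by omega), Nat.cast_sub hrm.le] at h1
    have hnr : (n₁ : ℝ) ≤ (n : ℝ) - r := by
      have : (n₁ : ℝ) + r ≤ n := by exact_mod_cast (by omega : n₁ + r ≤ n)
      linarith
    have hnr0 : (0 : ℝ) < (n : ℝ) - r := by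
      have : (r : ℝ) < n := by exact_mod_cast (by omega : r < n)
      linarith
    have h2 : (κ : ℝ) / d = ((m : ℝ) - r) / ((n : ℝ) - r) := by
      rw [div_eq_div_iff hd0'.ne' hnr0.ne']; linarith
    rw [h2]
    have h3 := hn₁.trans hnr
    rw [div_le_iff₀ hlam] at h3
    rw [mul_div_assoc', div_le_iff₀ hnr0]
    linarith
  refine ⟨{B ∈ P | powersetCard r B ∈ N}, ⟨?_, ?_⟩, ?_⟩
  · intro B hB
    exact hPc B (mem_filter.1 hB).1
  · intro e he B₁ hB₁ B₂ hB₂ h1 h2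
    rw [mem_filter] at hB₁ hB₂
    by_contra hne
    have := hN _ hB₁.2 _ hB₂.2 (fun h => hne (hinj _ hB₁.1 _ hB₂.1 h))
    exact disjoint_left.1 this (mem_powersetCard.2 ⟨h1, he⟩) (mem_powersetCard.2 ⟨h2, he⟩)
  · have h1 : #N ≤ #{B ∈ P | powersetCard r B ∈ N} := by
      have : N ⊆ ({B ∈ P | powersetCard r B ∈ N}).image (powersetCard r) := by
        intro e he
        obtain ⟨B, hB, rfl⟩ := mem_image.1 (hNE he)
        exact mem_image.2 ⟨B, mem_filter.2 ⟨hB, he⟩, rfl⟩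
      exact (card_le_card this).trans card_image_le
    have h2 : #(N.biUnion id) ≤ #N * k := by
      apply card_biUnion_le_card_mul
      intro e he
      obtain ⟨B, hB, rfl⟩ := mem_image.1 (hNE he)
      rw [id, card_powersetCard, hPc B hB]
    have h3 : #V ≤ #(V \ N.biUnion id) + #(N.biUnion id) := by
      have := le_card_sdiff (N.biUnion id) V
      omega
    have h1' : (#N : ℝ) ≤ #{B ∈ P | powersetCard r B ∈ N} := by exact_mod_cast h1
    have h2' : (#(N.biUnion id) : ℝ) ≤ #N * k := by exact_mod_cast h2
    have h3' : (#V : ℝ) ≤ #(V \ N.biUnion id) + #(N.biUnion id) := by exact_mod_cast h3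
    have hk0 : (0 : ℝ) < k := by exact_mod_cast hk1
    have hV0 : (0 : ℝ) ≤ #V := by positivity
    rw [← hVc, ← div_eq_mul_inv, div_le_iff₀ hk0]
    have h4 := mul_le_mul_of_nonneg_right hratio hV0
    have h5 := mul_le_mul_of_nonneg_right hu hV0
    have h6 := mul_le_mul_of_nonneg_right h1' hk0.le
    linarith

end

end Nib

/-- **Rödl.** For `r < m` and `λ > 0` there exists `n₀` such that for every `n > n₀`
there is a partial Steiner system with parameters `(r,m,n)` of size at least
`(1-λ) C(n,r) C(m,r)⁻¹`. -/
theorem stmt_5 (r m : ℕ) (hrm : r < m) (lam : ℝ) (hlam : 0 < lam) :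
    ∃ n₀ : ℕ, ∀ n, n₀ < n →
      ∃ D : Finset (Finset (Fin n)), IsSteiner r m n D ∧
        (1 - lam) * (n.choose r : ℝ) * ((m.choose r : ℝ))⁻¹ ≤ (D.card : ℝ) := by
  rcases Nat.eq_zero_or_pos r with rfl | hr
  · refine ⟨m, fun n hn => ?_⟩
    obtain ⟨B, _, hB⟩ := exists_subset_card_eq
      (show m ≤ #(univ : Finset (Fin n)) by simpa using hn.le)
    refine ⟨{B}, ⟨by simpa using hB, ?_⟩, ?_⟩
    · intro e _ B₁ h₁ B₂ h₂ _ _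
      rw [mem_singleton.1 h₁, mem_singleton.1 h₂]
    · simp
      linarith
  · exact Nib.main r m hr hrm lam hlam
end
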